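/- Let q be an odd prime power, d ≥ 2, and E ⊆ 𝔽_q^d. Then for every n ≥ 0, C_n ≤ |E|·((|E| + 2·q^{(d+1)/2})/q)^n. -/

import Mathlib

/-- `C_n`: the number of unit-distance chains of length `n` in `E ⊆ 𝔽_q^d`, i.e. tuples
`(x^1, …, x^{n+1}) ∈ E^{n+1}` with `‖x^i − x^{i+1}‖ = 1` for `1 ≤ i ≤ n`,
where `‖x‖ = x_1^2 + ⋯ + x_d^2`. -/
def chainCount {F : Type} [Field F] [Fintype F] [DecidableEq F] {d : ℕ}
    (E : Finset (Fin d → F)) (n : ℕ) : ℕ :=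
  (Finset.univ.filter (fun x : Fin (n + 1) → (Fin d → F) =>
    (∀ i, x i ∈ E) ∧ ∀ i : Fin n, ∑ j, (x i.castSucc j - x i.succ j) ^ 2 = 1)).card

section
open Polynomial

section Stepanov
variable {F : Type} [Field F]

lemma st_eval_zero (s : ℕ) (w : F[X][X]) (hw : ∀ j, (w.coeff j).natDegree < s)
    (h : w.eval (X ^ s) = 0) : w = 0 := by
  induction hn : w.natDegree using Nat.strong_induction_on generalizing w with
  | _ n ih =>
    have h0 : w.coeff 0 = 0 := by
      have e : w.eval (X ^ s) = w.divX.eval (X^s) * X ^ s + w.coeff 0 := by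
        conv_lhs => rw [← divX_mul_X_add w]
        simp
      rw [h] at e
      have hd : (X : F[X]) ^ s ∣ w.coeff 0 := by
        refine ⟨- w.divX.eval (X^s), ?_⟩
        linear_combination -e
      by_contra hne
      have := natDegree_le_of_dvd hd hne
      rw [natDegree_X_pow] at this
      have := hw 0
      omega
    have hX : w = w.divX * X := by
      conv_lhs => rw [← divX_mul_X_add w]
      rw [h0]; simp
    have he : w.divX.eval (X^s) = 0 := by
      rw [hX] at h
      simp only [eval_mul, eval_X] at h
      exact (mul_eq_zero.1 h).resolve_right (pow_ne_zero _ X_ne_zero)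
    by_cases hn0 : n = 0
    · subst hn0
      rw [eq_C_of_natDegree_eq_zero hn, h0]; simp
    · have := ih (w.divX.natDegree) (by rw [natDegree_divX_eq_natDegree_tsub_one]; omega) w.divX
        (fun j => by rw [coeff_divX]; exact hw _) he rfl
      rw [hX, this]; simp

lemma st_deg_mul {a b : ℕ} {v w : F[X][X]} (hv : ∀ j, (v.coeff j).natDegree ≤ a)
    (hw : ∀ j, (w.coeff j).natDegree ≤ b) : ∀ j, ((v * w).coeff j).natDegree ≤ a + b := by
  intro j
  rw [coeff_mul]
  refine natDegree_sum_le_of_forall_le _ _ ?_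
  intro x _
  exact natDegree_mul_le.trans (add_le_add (hv _) (hw _))

/-- no nontrivial solution of `v^2 = f(y) f(Y) w^2` -/
lemma st_nonsquare (f π : F[X]) (hπ : Prime π) (h1 : π ∣ f) (h2 : ¬ π ^ 2 ∣ f)
    (v w : F[X][X]) (h : v ^ 2 = C f * f.map C * w ^ 2) : w = 0 := by
  have hf : f ≠ 0 := by rintro rfl; simp at h2
  have hP : Prime (C π : F[X][X]) := prime_C_iff.2 hπ
  by_contra hw
  have hfm : f.map (C : F →+* F[X]) ≠ 0 := by
    rwa [Ne, Polynomial.map_eq_zero_iff (C_injective)]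
  have hCf : (C f : F[X][X]) ≠ 0 := by simpa using hf
  have hv : v ≠ 0 := by
    rintro rfl
    have := mul_ne_zero (mul_ne_zero hCf hfm) (pow_ne_zero 2 hw)
    apply this; rw [← h]; simp
  have fin : ∀ x : F[X][X], x ≠ 0 → FiniteMultiplicity (C π) x := fun x hx =>
    FiniteMultiplicity.of_prime_left hP hx
  have e := congrArg (emultiplicity (C π : F[X][X])) h
  rw [emultiplicity_mul hP, emultiplicity_mul hP, emultiplicity_pow hP, emultiplicity_pow hP] at e
  have e1 : emultiplicity (C π : F[X][X]) (C f) = 1 := by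
    rw [show (1 : ℕ∞) = ((1 : ℕ) : ℕ∞) from rfl, emultiplicity_eq_coe]
    constructor
    · rw [pow_one]; exact map_dvd C h1
    · intro h'
      rw [← C_pow, C_dvd_iff_dvd_coeff] at h'
      have := h' 0
      simp at this
      exact h2 this
  have e2 : emultiplicity (C π : F[X][X]) (f.map C) = 0 := by
    rw [emultiplicity_eq_zero]
    intro h'
    rw [C_dvd_iff_dvd_coeff] at h'
    have := h' f.natDegree
    rw [coeff_map] at this
    refine hπ.not_isUnit (isUnit_of_dvd_unit this ?_)
    rw [isUnit_C]
    simpa using hf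
  rw [e1, e2, (fin v hv).emultiplicity_eq_multiplicity, (fin w hw).emultiplicity_eq_multiplicity] at e
  norm_cast at e
  omega

/-- existence of the auxiliary coefficients -/
lemma st_exists (A B N : ℕ) (p₀ p₁ : Fin A → Fin B → F[X]) 
    (h0 : ∀ i j, p₀ i j ∈ degreeLT F N) (h1 : ∀ i j, p₁ i j ∈ degreeLT F N)
    (hN : N < 2 * (A * B)) :
    ∃ c₀ c₁ : Fin A → Fin B → F, (c₀ ≠ 0 ∨ c₁ ≠ 0) ∧
      (∑ i, ∑ j, c₀ i j • p₀ i j) + (∑ i, ∑ j, c₁ i j • p₁ i j) = 0 := by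
  let L : ((Fin A → Fin B → F) × (Fin A → Fin B → F)) →ₗ[F] degreeLT F N :=
    { toFun := fun c => (∑ i, ∑ j, c.1 i j • (⟨p₀ i j, h0 i j⟩ : degreeLT F N)) +
        (∑ i, ∑ j, c.2 i j • (⟨p₁ i j, h1 i j⟩ : degreeLT F N))
      map_add' := by
        intro x y
        simp only [Prod.fst_add, Prod.snd_add, Pi.add_apply, add_smul, Finset.sum_add_distrib]
        abel
      map_smul' := by
        intro r x
        simp only [Prod.smul_fst, Prod.smul_snd, Pi.smul_apply, smul_eq_mul, mul_smul,
          Finset.smul_sum, smul_add, RingHom.id_apply] }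
  have hker : LinearMap.ker L ≠ ⊥ := by
    apply LinearMap.ker_ne_bot_of_finrank_lt
    rw [(degreeLTEquiv F N).finrank_eq]
    simp [Module.finrank_pi_fintype, Module.finrank_prod]
    omega
  obtain ⟨x, hx, hx0⟩ := (Submodule.ne_bot_iff _).1 hker
  refine ⟨x.1, x.2, ?_, ?_⟩
  · by_contra hcon
    push Not at hcon
    exact hx0 (Prod.ext hcon.1 hcon.2)
  · have := congrArg (Subtype.val) (LinearMap.mem_ker.1 hx)
    simpa [L] using this

noncomputable def stW {A B : ℕ} (c : Fin A → Fin B → F) : F[X][X] :=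
  ∑ i : Fin A, ∑ j : Fin B, monomial (j : ℕ) (monomial (i : ℕ) (c i j))

lemma stW_coeff {A B : ℕ} (c : Fin A → Fin B → F) (n : ℕ) :
    (stW c).coeff n = ∑ i : Fin A, ∑ j : Fin B, if (j : ℕ) = n then monomial (i : ℕ) (c i j) else 0 := by
  simp [stW, finsetSum_coeff, coeff_monomial]

lemma stW_deg {A B : ℕ} (c : Fin A → Fin B → F) (n : ℕ) :
    ((stW c).coeff n).natDegree ≤ A - 1 := by
  rw [stW_coeff]
  refine natDegree_sum_le_of_forall_le _ _ fun i _ => natDegree_sum_le_of_forall_le _ _ fun j _ => ?_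
  split_ifs
  · exact (natDegree_monomial_le _).trans (by omega)
  · simp

lemma stW_eq_zero {A B : ℕ} (c : Fin A → Fin B → F) (h : stW c = 0) : c = 0 := by
  funext i j
  have := congrArg (fun w => (w.coeff (j : ℕ)).coeff (i : ℕ)) h
  simp only [stW_coeff, finsetSum_coeff, coeff_zero] at this
  rw [Finset.sum_eq_single i, Finset.sum_eq_single j] at this
  · simpa using this
  · intro b _ hb
    rw [if_neg (fun h => hb (Fin.ext h))]; simp
  · simp
  · intro b _ hb
    refine Finset.sum_eq_zero fun k _ => ?_
    split_ifs
    · rw [coeff_monomial, if_neg (fun h => hb (Fin.ext h))]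
    · simp
  · simp

lemma stW_eval {A B : ℕ} (c : Fin A → Fin B → F) (s : ℕ) :
    (stW c).eval (X ^ s) = ∑ i : Fin A, ∑ j : Fin B, c i j • (X : F[X]) ^ ((i : ℕ) + s * j) := by
  simp only [stW, eval_finsetSum, eval_monomial, ← pow_mul]
  refine Finset.sum_congr rfl fun i _ => Finset.sum_congr rfl fun j _ => ?_
  rw [← C_mul_X_pow_eq_monomial, smul_eq_C_mul, mul_assoc, ← pow_add]

end Stepanov
end

section
open Polynomial

section Stepanov
variable {F : Type} [Field F] [Fintype F]

lemma st_frob {K : Type} [CommRing K] [Algebra F K]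
    (q : ℕ) (hq : Fintype.card F = q) (m : ℕ) (y : K) (p : F[X]) :
    (aeval y p) ^ q ^ m = aeval (y ^ q ^ m) p := by
  induction m generalizing y with
  | zero => simp
  | succ m ih =>
    rw [pow_succ, pow_mul, pow_mul, ih]
    have h := Polynomial.aeval_algHom_apply (FiniteField.frobeniusAlgHom F K) (y ^ q ^ m) p
    simp only [FiniteField.coe_frobeniusAlgHom, hq] at h
    exact h.symm

lemma st_nonzero (q m h A B : ℕ) (hq : Fintype.card F = q) (hs : q ^ m = 2 * h + 1)
    (hA : A + q ≤ h) (hA1 : 1 ≤ A) (f : F[X]) (hf : f.natDegree ≤ 2 * q)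
    (π : F[X]) (hπ : Prime π) (h1 : π ∣ f) (h2 : ¬ π ^ 2 ∣ f)
    (c₀ c₁ : Fin A → Fin B → F) (hc : c₀ ≠ 0 ∨ c₁ ≠ 0) :
    (stW c₀).eval (X ^ q ^ m) - f ^ (h + 1) * (stW c₁).eval (X ^ q ^ m) ≠ 0 := by
  intro hG
  have key : (stW c₀) ^ 2 - C f * f.map C * (stW c₁) ^ 2 = 0 := by
    apply st_eval_zero (q ^ m)
    · intro j
      rw [coeff_sub]
      have d0 := st_deg_mul (stW_deg c₀) (stW_deg c₀)
      have d1 := st_deg_mul (stW_deg c₁) (stW_deg c₁)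
      have df : ∀ j, ((f.map C : F[X][X]).coeff j).natDegree ≤ 0 := by
        intro j; simp
      have dC : ∀ j, ((C f : F[X][X]).coeff j).natDegree ≤ 2 * q := by
        intro j; rw [coeff_C]; split_ifs
        · exact hf
        · simp
      have d2 := st_deg_mul (st_deg_mul dC df) d1
      rw [sq, sq]
      refine lt_of_le_of_lt (natDegree_sub_le _ _) (max_lt ?_ ?_)
      · have := d0 j; omega
      · have := d2 j; omega
    · have e : (f.map C : F[X][X]).eval (X ^ q ^ m) = f ^ q ^ m := by
        have := st_frob q hq m (X : F[X]) f
        rw [aeval_X_left_apply] at this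
        rw [this, eval_map]
        rfl
      simp only [eval_sub, eval_mul, eval_pow, eval_C, e]
      have h3 : (stW c₀).eval (X ^ q ^ m) = f ^ (h + 1) * (stW c₁).eval (X ^ q ^ m) := sub_eq_zero.1 hG
      rw [h3, hs]
      ring
  have hw1 := st_nonsquare f π hπ h1 h2 _ _ (sub_eq_zero.1 key)
  have hc1 := stW_eq_zero _ hw1
  rw [hw1] at key
  have hw0 : stW c₀ = 0 := by simpa using key
  have hc0 := stW_eq_zero _ hw0
  tauto

theorem stepanov {K : Type} [Field K] [Fintype K] [DecidableEq K] [Algebra F K]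
    (q m h : ℕ) (hq : Fintype.card F = q) (hs : q ^ m = 2 * h + 1)
    (hK : Fintype.card K = (q ^ m) ^ 2) (hh : q ^ 2 + 3 * q + 1 < h)
    (f : F[X]) (hf : f.natDegree ≤ 2 * q)
    (π : F[X]) (hπ : Prime π) (h1 : π ∣ f) (h2 : ¬ π ^ 2 ∣ f) :
    (Finset.univ.filter (fun y : K => (aeval y f) ^ (2 * h * (h + 1)) = -1)).card ≤
      h + q ^ m * (h + q + 2) + q * (q ^ m + 1) := by
  obtain ⟨A, hA⟩ : ∃ A, h = A + q := ⟨h - q, by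
    have : q ≤ q ^ 2 + 3 * q + 1 := by nlinarith
    omega⟩
  have hA1 : 1 ≤ A := by
    by_contra hcon
    have : q ≤ q ^ 2 + 3 * q + 1 := by nlinarith
    omega
  set B := h + q + 2 with hB
  set s := q ^ m with hsdef
  have hmono : ∀ (i : Fin A) (j : Fin B), s * (i : ℕ) + (j : ℕ) + 1 + s ≤ s * A + B := by
    intro i j
    have hi := i.2
    have hj := j.2
    have : s * ((i : ℕ) + 1) ≤ s * A := Nat.mul_le_mul_left _ hi
    rw [mul_add, mul_one] at this
    omega
  obtain ⟨c₀, c₁, hc, hR⟩ := st_exists A B (s * A + B + q * (s + 1))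
    (fun i j => X ^ (s * (i : ℕ) + (j : ℕ)) : Fin A → Fin B → F[X])
    (fun i j => f ^ (h + 1) * X ^ (s * (i : ℕ) + (j : ℕ)))
    (by
      intro i j
      rw [mem_degreeLT]
      refine (degree_X_pow_le _).trans_lt ?_
      have := hmono i j
      exact_mod_cast (by omega))
    (by
      intro i j
      rw [mem_degreeLT]
      refine (degree_le_natDegree).trans_lt ?_
      have := hmono i j
      have h3 : (f ^ (h + 1) * X ^ (s * (i : ℕ) + (j : ℕ))).natDegree ≤
        (h + 1) * (2 * q) + (s * (i : ℕ) + (j : ℕ)) :=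
        natDegree_mul_le.trans (add_le_add (natDegree_pow_le.trans (Nat.mul_le_mul_left _ hf))
          (natDegree_X_pow_le _))
      have h4 : (h + 1) * (2 * q) = q * (s + 1) := by rw [hs]; ring
      exact_mod_cast (by omega))
    (by
      rw [hs, hB, hA]
      rw [hA] at hh
      have h5 : q ^ 2 + 2 * q + 1 < A := by omega
      nlinarith)
  set G : F[X] := (stW c₀).eval (X ^ q ^ m) - f ^ (h + 1) * (stW c₁).eval (X ^ q ^ m) with hG
  have hG0 : G ≠ 0 := st_nonzero q m h A B hq hs (by omega) hA1 f hf π hπ h1 h2 c₀ c₁ hc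
  have hGe : G = (∑ i, ∑ j, c₀ i j • (X : F[X]) ^ ((i : ℕ) + s * j)) -
      f ^ (h + 1) * ∑ i, ∑ j, c₁ i j • (X : F[X]) ^ ((i : ℕ) + s * j) := by
    rw [hG, stW_eval, stW_eval]
  have hdeg1 : ∀ c : Fin A → Fin B → F,
      (∑ i, ∑ j, c i j • (X : F[X]) ^ ((i : ℕ) + s * (j : ℕ))).natDegree ≤ h + s * B := by
    intro c
    refine natDegree_sum_le_of_forall_le _ _ fun i _ => natDegree_sum_le_of_forall_le _ _ fun j _ => ?_
    refine (natDegree_smul_le _ _).trans ((natDegree_X_pow_le _).trans ?_)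
    have hi := i.2
    have : s * (j : ℕ) ≤ s * B := Nat.mul_le_mul_left _ j.2.le
    omega
  have hdeg : G.natDegree ≤ h + s * B + q * (s + 1) := by
    rw [hGe]
    refine (natDegree_sub_le _ _).trans (max_le ?_ ?_)
    · have := hdeg1 c₀; omega
    · have h4 : (h + 1) * (2 * q) = q * (s + 1) := by rw [hs]; ring
      refine natDegree_mul_le.trans ?_
      have h5 := natDegree_pow_le.trans (Nat.mul_le_mul_left (h+1) hf) 
      have := hdeg1 c₁
      omega
  have hGm : (G.map (algebraMap F K)) ≠ 0 := by
    rwa [Ne, Polynomial.map_eq_zero_iff (algebraMap F K).injective]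
  have hsub : Finset.univ.filter (fun y : K => (aeval y f) ^ (2 * h * (h + 1)) = -1) ⊆
      (G.map (algebraMap F K)).roots.toFinset := by
    intro y hy
    simp only [Finset.mem_filter, Finset.mem_univ, true_and] at hy
    rw [Multiset.mem_toFinset, mem_roots hGm, IsRoot.def, eval_map_algebraMap]
    have hys : y ^ (s * s) = y := by
      rw [← sq, ← hK]; exact FiniteField.pow_card y
    have hpow : ∀ i j : ℕ, (y ^ s) ^ (i + s * j) = y ^ (s * i + j) := by
      intro i j
      rw [← pow_mul, mul_add, ← mul_assoc, pow_add, pow_mul y (s * s), hys, ← pow_add]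
    have h6 : (aeval y G) ^ s = 0 := by
      rw [hsdef, st_frob q hq m y G, ← hsdef, hGe]
      have h7 := congrArg (aeval y) hR
      have h8 : aeval (y ^ s) f ^ (h + 1) = - (aeval y f) ^ (h + 1) := by
        rw [hsdef, ← st_frob q hq m y f, ← hsdef, ← pow_mul,
          show s * (h + 1) = 2 * h * (h + 1) + (h + 1) by rw [hs]; ring, pow_add, hy]
        ring
      simp only [map_add, map_sum, map_smul, map_mul, map_pow, aeval_X, map_zero] at h7
      simp only [map_sub, map_sum, map_smul, map_mul, map_pow, aeval_X, hpow, h8]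
      rw [← h7]
      simp only [← mul_smul_comm, ← Finset.mul_sum]
      ring
    exact pow_eq_zero_iff (by omega) |>.1 h6
  calc _ ≤ _ := Finset.card_le_card hsub
    _ ≤ _ := Multiset.toFinset_card_le _
    _ ≤ _ := card_roots' _
    _ ≤ G.natDegree := natDegree_map_le
    _ ≤ _ := hdeg

end Stepanov
end

section
open Polynomial

section Count
variable {F : Type} [Field F] [Fintype F]

noncomputable def klF (q : ℕ) (u : F) : F[X] := (X ^ q - X) ^ 2 - C (4 * u)

lemma klF_natDegree (q : ℕ) (hq1 : 1 < q) (u : F) : (klF q u).natDegree = 2 * q := by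
  have h1 : (X ^ q - X : F[X]).natDegree = q := FiniteField.X_pow_card_sub_X_natDegree_eq F hq1
  rw [klF, natDegree_sub_C, natDegree_pow, h1]

lemma klF_prime (q : ℕ) (hq : Fintype.card F = q) (h2 : (2 : F) ≠ 0) (u : F) (hu : u ≠ 0) :
    ∃ π : F[X], Prime π ∧ π ∣ klF q u ∧ ¬ π ^ 2 ∣ klF q u := by
  have hq1 : 1 < q := hq ▸ Fintype.one_lt_card
  have hd := klF_natDegree q hq1 u
  have hnu : ¬ IsUnit (klF q u) := fun h => by
    have := natDegree_eq_zero_of_isUnit h; omega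
  have hn0 : klF q u ≠ 0 := fun h => by rw [h] at hd; simp at hd; omega
  obtain ⟨π, hπ, hdvd⟩ := WfDvdMonoid.exists_irreducible_factor hnu hn0
  refine ⟨π, hπ.prime, hdvd, fun hsq => ?_⟩
  have hder : derivative (klF q u) = C (-2) * (X ^ q - X) := by
    have hc : (q : F) = 0 := by rw [← hq]; exact Nat.cast_card_eq_zero F
    simp only [klF, derivative_sub, derivative_C, derivative_pow, derivative_X]
    simp [hc]
  have h3 : π ∣ derivative (klF q u) := by
    obtain ⟨g, hg⟩ := hsq
    rw [hg, derivative_mul, derivative_pow]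
    refine dvd_add (Dvd.dvd.mul_right ?_ _) (Dvd.dvd.mul_right ?_ _)
    · simp only [Nat.cast_ofNat, Nat.add_one_sub_one, pow_one]
      exact Dvd.dvd.mul_right (Dvd.dvd.mul_left dvd_rfl _) _
    · exact dvd_pow_self _ (by norm_num)
  rw [hder] at h3
  have h4 : π ∣ X ^ q - X := by
    rcases hπ.prime.dvd_or_dvd h3 with h | h
    · exfalso
      refine hπ.not_isUnit (isUnit_of_dvd_unit h ?_)
      rw [isUnit_C]; simpa using h2
    · exact h
  have h5 : π ∣ C (4 * u) := by
    have : C (4 * u) = (X ^ q - X) * (X ^ q - X) - klF q u := by rw [klF]; ring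
    rw [this]
    exact dvd_sub (Dvd.dvd.mul_left h4 _) hdvd
  refine hπ.not_isUnit (isUnit_of_dvd_unit h5 ?_)
  rw [isUnit_C]
  have : (4 : F) = 2 * 2 := by norm_num
  rw [this]
  simpa [hu] using h2

variable {K : Type} [Field K] [Fintype K] [DecidableEq K] [DecidableEq F] [Algebra F K]

/-- trace-zero points of the Kloosterman curve -/
theorem count_lower (q m h : ℕ) (hq : Fintype.card F = q) (hs : q ^ m = 2 * h + 1)
    (h2 : (2 : F) ≠ 0)
    (hK : Fintype.card K = (q ^ m) ^ 2) (hh : q ^ 2 + 3 * q + 1 < h) (u : F) (hu : u ≠ 0) :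
    2 * (q ^ m) ^ 2 ≤ q * (Finset.univ.filter (fun x : K => x ≠ 0 ∧
      Algebra.trace F K (x + algebraMap F K u * x⁻¹) = 0)).card +
      2 * (h + q ^ m * (h + q + 2) + q * (q ^ m + 1)) + 4 * q := by
  have hq1 : 1 < q := hq ▸ Fintype.one_lt_card
  set U := algebraMap F K u with hU
  have hU0 : U ≠ 0 := by rw [hU]; simpa using hu
  have h2K : (2 : K) ≠ 0 := by
    have := (map_ne_zero (algebraMap F K)).2 h2
    rwa [map_ofNat] at this
  obtain ⟨π, hπ, hd1, hd2⟩ := klF_prime q hq h2 u hu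
  have hst := stepanov (K := K) q m h hq hs hK hh (klF q u) (klF_natDegree q hq1 u).le π hπ hd1 hd2
  have hfe : ∀ y : K, aeval y (klF q u) = (y ^ q - y) ^ 2 - 4 * U := by
    intro y; simp [klF, hU]; left; exact map_ofNat _ 4
  set r : K → K → Prop := fun y x => x ≠ 0 ∧ y ^ q - y = x + U * x⁻¹ with hr
  classical
  have hdc := Finset.sum_card_bipartiteAbove_eq_sum_card_bipartiteBelow
    (s := (Finset.univ : Finset K)) (t := (Finset.univ : Finset K)) r
  -- upper
  have hup : ∑ x : K, (Finset.bipartiteBelow r Finset.univ x).card ≤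
      q * (Finset.univ.filter (fun x : K => x ≠ 0 ∧
      Algebra.trace F K (x + U * x⁻¹) = 0)).card := by
    rw [Finset.card_filter, Finset.mul_sum]
    refine Finset.sum_le_sum fun x _ => ?_
    split_ifs with hx
    · set p : K[X] := (X ^ q - X) - C (x + U * x⁻¹) with hp
      have hpd : p.natDegree = q := by
        rw [hp, natDegree_sub_C]; exact FiniteField.X_pow_card_sub_X_natDegree_eq K hq1
      have hp0 : p ≠ 0 := fun h => by rw [h] at hpd; simp at hpd; omega
      have hsub : Finset.bipartiteBelow r Finset.univ x ⊆ p.roots.toFinset := by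
        intro y hy
        simp only [Finset.mem_bipartiteBelow, Finset.mem_univ, true_and, hr] at hy
        rw [Multiset.mem_toFinset, mem_roots hp0, IsRoot.def, hp]
        simp only [eval_sub, eval_pow, eval_X, eval_C]
        rw [hy.2]; ring
      rw [mul_one]
      calc _ ≤ _ := Finset.card_le_card hsub
        _ ≤ _ := Multiset.toFinset_card_le _
        _ ≤ _ := card_roots' _
        _ = q := hpd
    · rw [mul_zero, Nat.le_zero, Finset.card_eq_zero, Finset.eq_empty_iff_forall_notMem]
      intro y hy
      simp only [Finset.mem_bipartiteBelow, Finset.mem_univ, true_and, hr] at hy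
      apply hx
      refine ⟨hy.1, ?_⟩
      rw [← hy.2, map_sub, sub_eq_zero]
      have := Algebra.trace_eq_of_algEquiv (FiniteField.frobeniusAlgEquivOfAlgebraic F K) y
      rwa [FiniteField.coe_frobeniusAlgEquivOfAlgebraic, hq] at this
  -- lower
  set Sm := Finset.univ.filter (fun y : K => (aeval y (klF q u)) ^ (2 * h * (h + 1)) = -1) with hSm
  set S0 := Finset.univ.filter (fun y : K => aeval y (klF q u) = 0) with hS0
  have hS0c : S0.card ≤ 2 * q := by
    have hp0 : (klF q u).map (algebraMap F K) ≠ 0 := by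
      rw [Ne, Polynomial.map_eq_zero_iff (algebraMap F K).injective]
      intro h
      have := klF_natDegree q hq1 u
      rw [h] at this; simp at this; omega
    have hsub : S0 ⊆ ((klF q u).map (algebraMap F K)).roots.toFinset := by
      intro y hy
      simp only [hS0, Finset.mem_filter, Finset.mem_univ, true_and] at hy
      rw [Multiset.mem_toFinset, mem_roots hp0, IsRoot.def, eval_map_algebraMap, hy]
    calc _ ≤ _ := Finset.card_le_card hsub
        _ ≤ _ := Multiset.toFinset_card_le _
        _ ≤ _ := card_roots' _
        _ ≤ _ := natDegree_map_le
        _ = _ := klF_natDegree q hq1 u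
  have hlow : 2 * (Finset.univ \ (Sm ∪ S0)).card ≤
      ∑ y : K, (Finset.bipartiteAbove r Finset.univ y).card := by
    calc 2 * (Finset.univ \ (Sm ∪ S0)).card = ∑ y ∈ Finset.univ \ (Sm ∪ S0), 2 := by
          simp [mul_comm]
      _ ≤ ∑ y ∈ Finset.univ \ (Sm ∪ S0), (Finset.bipartiteAbove r Finset.univ y).card := by
          refine Finset.sum_le_sum fun y hy => ?_
          simp only [Finset.mem_sdiff, Finset.mem_univ, true_and, Finset.mem_union, not_or, hSm, hS0,
            Finset.mem_filter] at hy
          obtain ⟨hy1, hy0⟩ := hy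
          have hch : ringChar K ≠ 2 := by
            intro hc
            have : ((2 : ℕ) : K) = 0 := by rw [← hc]; exact ringChar.Nat.cast_ringChar
            exact h2K (by exact_mod_cast this)
          have hcard2 : Fintype.card K / 2 = 2 * h * (h + 1) := by
            rw [hK, hs]
            have : (2 * h + 1) ^ 2 = 2 * (2 * h * (h + 1)) + 1 := by ring
            omega
          have hsq : IsSquare (aeval y (klF q u)) := by
            rw [FiniteField.isSquare_iff hch hy0, hcard2]
            have := FiniteField.pow_dichotomy hch hy0
            rw [hcard2] at this
            tauto
          obtain ⟨d, hd⟩ := hsq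
          have hd0 : d ≠ 0 := by rintro rfl; apply hy0; rw [hd]; ring
          rw [hfe] at hd
          set t := y ^ q - y
          have root : ∀ e : K, e * e = d * d → (t + e) / 2 ∈ Finset.bipartiteAbove r Finset.univ y := by
            intro e he
            rw [← hd] at he
            have hx : (t + e) / 2 * (t - (t + e) / 2) = U := by
              field_simp
              linear_combination -he
            have hx0 : (t + e) / 2 ≠ 0 := by
              intro h0; rw [h0] at hx; simp at hx; exact hU0 hx.symm
            simp only [Finset.mem_bipartiteAbove, Finset.mem_univ, true_and, hr]
            refine ⟨hx0, ?_⟩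
            change t = _
            rw [← hx]
            generalize (t+e)/2 = x at *
            field_simp
            ring
          have hsub : ({(t + d) / 2, (t + -d) / 2} : Finset K) ⊆ Finset.bipartiteAbove r Finset.univ y := by
            intro x hx
            simp only [Finset.mem_insert, Finset.mem_singleton] at hx
            rcases hx with rfl | rfl
            · exact root _ rfl
            · exact root _ (by ring)
          have := Finset.card_le_card hsub
          rwa [Finset.card_pair] at this
          intro h
          field_simp at h
          apply hd0
          have : (2 : K) * d = 0 := by linear_combination h
          exact (mul_eq_zero.1 this).resolve_left h2K
      _ ≤ _ := Finset.sum_le_sum_of_subset (Finset.subset_univ _)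
  have hcc : Fintype.card K ≤ (Finset.univ \ (Sm ∪ S0)).card + Sm.card + S0.card := by
    have := Finset.card_sdiff_add_card_eq_card (Finset.subset_univ (Sm ∪ S0))
    have h3 := Finset.card_union_le Sm S0
    rw [Finset.card_univ] at this
    omega
  rw [hK] at hcc
  omega

end Count
end

section
open Polynomial

section LFun
variable {F : Type} [Field F]

open Classical in
noncomputable def lam (ψ : AddChar F ℂ) (u : F) (g : F[X]) : ℂ :=
  if g.coeff 0 = 0 then 0 else ψ (-g.nextCoeff - u * (g.coeff 1 / g.coeff 0))

lemma lam_one (ψ : AddChar F ℂ) (u : F) : lam ψ u 1 = 1 := by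
  simp [lam, nextCoeff, coeff_one]

lemma lam_mul (ψ : AddChar F ℂ) (u : F) {g h : F[X]} (hg : g.Monic) (hh : h.Monic) :
    lam ψ u (g * h) = lam ψ u g * lam ψ u h := by
  unfold lam
  rw [mul_coeff_zero, mul_coeff_one, hg.nextCoeff_mul hh]
  by_cases h1 : g.coeff 0 = 0
  · simp [h1]
  by_cases h2 : h.coeff 0 = 0
  · simp [h2]
  rw [if_neg (mul_ne_zero h1 h2), if_neg h1, if_neg h2, ← AddChar.map_add_eq_mul]
  congr 1
  field_simp
  ring

lemma lam_pow (ψ : AddChar F ℂ) (u : F) {g : F[X]} (hg : g.Monic) (j : ℕ) :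
    lam ψ u (g ^ j) = lam ψ u g ^ j := by
  induction j with
  | zero => simp [lam_one]
  | succ j ih => rw [pow_succ, lam_mul _ _ (hg.pow j) hg, ih, pow_succ]

variable [Fintype F]

variable (F) in
lemma Mon_finite (n : ℕ) : {g : F[X] | g.Monic ∧ g.natDegree = n}.Finite := by
  refine Set.Finite.of_injOn (f := fun g : F[X] => fun i : Fin n => g.coeff i) (t := Set.univ)
    (fun _ _ => Set.mem_univ _) ?_ Set.finite_univ
  rintro g ⟨hg, hgn⟩ h ⟨hh, hhn⟩ e
  ext i
  rcases lt_trichotomy i n with hi | hi | hi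
  · exact congrFun e ⟨i, hi⟩
  · subst hi
    conv_lhs => rw [← hgn]
    conv_rhs => rw [← hhn]
    rw [hg.coeff_natDegree, hh.coeff_natDegree]
  · rw [coeff_eq_zero_of_natDegree_lt (by omega), coeff_eq_zero_of_natDegree_lt (by omega)]

variable (F) in
noncomputable def Mon (n : ℕ) : Finset F[X] := (Mon_finite F n).toFinset

lemma mem_Mon {n : ℕ} {g : F[X]} : g ∈ Mon F n ↔ g.Monic ∧ g.natDegree = n := by
  simp [Mon]

open Classical in
variable (F) in
noncomputable def Irr (n : ℕ) : Finset F[X] :=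
  ((Finset.range (n + 1)).biUnion (Mon F)).filter Irreducible

lemma mem_Irr {n : ℕ} {g : F[X]} : g ∈ Irr F n ↔ g.Monic ∧ g.natDegree ≤ n ∧ Irreducible g := by
  simp only [Irr, Finset.mem_filter, Finset.mem_biUnion, Finset.mem_range, mem_Mon]
  constructor
  · rintro ⟨⟨a, ha, h1, h2⟩, h3⟩
    exact ⟨h1, by omega, h3⟩
  · rintro ⟨h1, h2, h3⟩
    exact ⟨⟨_, by omega, h1, rfl⟩, h3⟩

noncomputable def LS (ψ : AddChar F ℂ) (u : F) (n : ℕ) : ℂ := ∑ g ∈ Mon F n, lam ψ u g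

noncomputable def LV (ψ : AddChar F ℂ) (u : F) (k : ℕ) : ℂ :=
  ∑ P ∈ Irr F k, ∑ j ∈ Finset.Icc 1 k, if j * P.natDegree = k then P.natDegree * lam ψ u P ^ j else 0

lemma deg_eq_sum (n : ℕ) (g : F[X]) (hg : g ∈ Mon F n) [DecidableEq F[X]] [DecidableRel (α := F[X]) (· ∣ ·)]:
    n = ∑ P ∈ Irr F n, ∑ j ∈ Finset.Icc 1 n, if P ^ j ∣ g then P.natDegree else 0 := by
  classical
  obtain ⟨hm, hn⟩ := mem_Mon.1 hg
  have hg0 : g ≠ 0 := hm.ne_zero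
  have hprod : (UniqueFactorizationMonoid.normalizedFactors g).prod = g := by
    rw [UniqueFactorizationMonoid.prod_normalizedFactors_eq hg0, hm.normalize_eq_self]
  have hirr : ∀ P ∈ UniqueFactorizationMonoid.normalizedFactors g, P.Monic ∧ Irreducible P ∧ P ∣ g := by
    intro P hP
    have h1 := UniqueFactorizationMonoid.irreducible_of_normalized_factor P hP
    refine ⟨?_, h1, UniqueFactorizationMonoid.dvd_of_mem_normalizedFactors hP⟩
    have := UniqueFactorizationMonoid.normalize_normalized_factor P hP
    rw [← this]
    exact monic_normalize h1.ne_zero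
  have hsub : (UniqueFactorizationMonoid.normalizedFactors g).toFinset ⊆ Irr F n := by
    intro P hP
    obtain ⟨h1, h2, h3⟩ := hirr P (Multiset.mem_toFinset.1 hP)
    exact mem_Irr.2 ⟨h1, hn ▸ natDegree_le_of_dvd h3 hg0, h2⟩
  have hdeg : n = ((UniqueFactorizationMonoid.normalizedFactors g).map natDegree).sum := by
    rw [← natDegree_multiset_prod_of_monic _ (fun P hP => (hirr P hP).1), hprod, hn]
  conv_lhs => rw [hdeg]
  rw [Finset.sum_multiset_map_count]
  rw [Finset.sum_subset hsub (by
    intro P _ hP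
    rw [Multiset.mem_toFinset] at hP
    rw [Multiset.count_eq_zero_of_notMem hP, zero_smul])]
  refine Finset.sum_congr rfl fun P hP => ?_
  obtain ⟨h1, h2, h3⟩ := mem_Irr.1 hP
  rw [← Finset.sum_filter, Finset.sum_const]
  congr 1
  have hdvd : ∀ j, P ^ j ∣ g ↔ j ≤ Multiset.count P (UniqueFactorizationMonoid.normalizedFactors g) := by
    intro j
    rw [pow_dvd_iff_le_emultiplicity,
      UniqueFactorizationMonoid.emultiplicity_eq_count_normalizedFactors h3 hg0, h1.normalize_eq_self]
    norm_cast
  have hle : Multiset.count P (UniqueFactorizationMonoid.normalizedFactors g) ≤ n := by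
    have h4 := (hdvd _).2 le_rfl
    have h5 := natDegree_le_of_dvd h4 hg0
    rw [natDegree_pow, hn] at h5
    have := h3.natDegree_pos
    nlinarith
  have : Finset.filter (fun j => P ^ j ∣ g) (Finset.Icc 1 n) =
      Finset.Icc 1 (Multiset.count P (UniqueFactorizationMonoid.normalizedFactors g)) := by
    ext j
    simp only [Finset.mem_filter, Finset.mem_Icc, hdvd]
    omega
  rw [this]; simp

lemma sum_dvd (ψ : AddChar F ℂ) (u : F) (n : ℕ) (Q : F[X]) (hQ : Q.Monic) (hn : Q.natDegree ≤ n)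
    [DecidableRel (α := F[X]) (· ∣ ·)] :
    ∑ g ∈ Mon F n with Q ∣ g, lam ψ u g = lam ψ u Q * LS ψ u (n - Q.natDegree) := by
  rw [LS, Finset.mul_sum]
  symm
  refine Finset.sum_bij (fun h _ => Q * h) ?_ ?_ ?_ ?_
  · intro h hh
    obtain ⟨h1, h2⟩ := mem_Mon.1 hh
    rw [Finset.mem_filter, mem_Mon]
    refine ⟨⟨hQ.mul h1, ?_⟩, dvd_mul_right _ _⟩
    rw [hQ.natDegree_mul h1]; omega
  · intro a _ b _ hab
    exact mul_left_cancel₀ hQ.ne_zero hab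
  · intro g hg
    rw [Finset.mem_filter, mem_Mon] at hg
    obtain ⟨⟨h1, h2⟩, h, rfl⟩ := hg
    have hm : h.Monic := hQ.of_mul_monic_left h1
    refine ⟨h, mem_Mon.2 ⟨hm, ?_⟩, rfl⟩
    rw [hQ.natDegree_mul hm] at h2; omega
  · intro h hh
    rw [lam_mul _ _ hQ (mem_Mon.1 hh).1]

lemma LV_extend (ψ : AddChar F ℂ) (u : F) (k n : ℕ) (hk1 : 1 ≤ k) (hk : k ≤ n) :
    LV ψ u k = ∑ P ∈ Irr F n, ∑ j ∈ Finset.Icc 1 n,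
      if j * P.natDegree = k then P.natDegree * lam ψ u P ^ j else 0 := by
  have h1 : Irr F k ⊆ Irr F n := by
    intro P hP
    rw [mem_Irr] at hP ⊢
    exact ⟨hP.1, hP.2.1.trans hk, hP.2.2⟩
  rw [LV, ← Finset.sum_subset h1]
  · refine Finset.sum_congr rfl fun P hP => ?_
    refine Finset.sum_subset (Finset.Icc_subset_Icc_right hk) ?_
    intro j hj hj'
    simp only [Finset.mem_Icc, not_and, not_le] at hj hj'
    have := (mem_Irr.1 hP).2.2.natDegree_pos
    rw [if_neg]
    have := hj' hj.1
    nlinarith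
  · intro P hP hP'
    refine Finset.sum_eq_zero fun j hj => ?_
    rw [if_neg]
    intro he
    apply hP'
    rw [mem_Irr] at hP ⊢
    refine ⟨hP.1, ?_, hP.2.2⟩
    rw [← he]
    exact Nat.le_mul_of_pos_left _ (Finset.mem_Icc.1 hj).1

theorem newton (ψ : AddChar F ℂ) (u : F) (n : ℕ) :
    (n : ℂ) * LS ψ u n = ∑ k ∈ Finset.Icc 1 n, LV ψ u k * LS ψ u (n - k) := by
  classical
  have hR : ∑ k ∈ Finset.Icc 1 n, LV ψ u k * LS ψ u (n - k) =
      ∑ P ∈ Irr F n, ∑ j ∈ Finset.Icc 1 n, if j * P.natDegree ≤ n then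
        (P.natDegree * lam ψ u P ^ j) * LS ψ u (n - j * P.natDegree) else 0 := by
    calc _ = ∑ k ∈ Finset.Icc 1 n, ∑ P ∈ Irr F n, ∑ j ∈ Finset.Icc 1 n,
        if j * P.natDegree = k then (P.natDegree * lam ψ u P ^ j) * LS ψ u (n - k) else 0 := by
          refine Finset.sum_congr rfl fun k hk => ?_
          rw [Finset.mem_Icc] at hk
          rw [LV_extend ψ u k n hk.1 hk.2, Finset.sum_mul]
          refine Finset.sum_congr rfl fun P _ => ?_
          rw [Finset.sum_mul]
          refine Finset.sum_congr rfl fun j _ => ?_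
          rw [ite_mul, zero_mul]
      _ = _ := by
          rw [Finset.sum_comm]
          refine Finset.sum_congr rfl fun P hP => ?_
          rw [Finset.sum_comm]
          refine Finset.sum_congr rfl fun j hj => ?_
          rw [Finset.sum_ite_eq]
          have h1 := (mem_Irr.1 hP).2.2.natDegree_pos
          have h2 := (Finset.mem_Icc.1 hj).1
          have : 1 ≤ j * P.natDegree := Nat.mul_pos h2 h1
          simp [this]
  rw [hR]
  have hL : (n : ℂ) * LS ψ u n = ∑ g ∈ Mon F n, ∑ P ∈ Irr F n, ∑ j ∈ Finset.Icc 1 n,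
      if P ^ j ∣ g then (P.natDegree : ℂ) * lam ψ u g else 0 := by
    rw [LS, Finset.mul_sum]
    refine Finset.sum_congr rfl fun g hg => ?_
    conv_lhs => rw [deg_eq_sum n g hg]
    push_cast
    rw [Finset.sum_mul]
    refine Finset.sum_congr rfl fun P _ => ?_
    rw [Finset.sum_mul]
    refine Finset.sum_congr rfl fun j _ => ?_
    rw [ite_mul, zero_mul]
  rw [hL, Finset.sum_comm]
  refine Finset.sum_congr rfl fun P hP => ?_
  rw [Finset.sum_comm]
  refine Finset.sum_congr rfl fun j hj => ?_
  obtain ⟨hm, _, hi⟩ := mem_Irr.1 hP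
  rw [← Finset.sum_filter, ← Finset.mul_sum]
  split_ifs with h
  · rw [sum_dvd ψ u n (P ^ j) (hm.pow j) (by rwa [natDegree_pow]), lam_pow _ _ hm, natDegree_pow]
    ring
  · rw [Finset.filter_false_of_mem]
    · simp
    · intro g hg hd
      obtain ⟨h1, h2⟩ := mem_Mon.1 hg
      have := natDegree_le_of_dvd hd h1.ne_zero
      rw [natDegree_pow] at this
      omega

end LFun
end

section
open Polynomial

section LVals
variable {F : Type} [Field F] [Fintype F] [DecidableEq F]

lemma LS_zero (ψ : AddChar F ℂ) (u : F) : LS ψ u 0 = 1 := by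
  have : Mon F 0 = {1} := by
    ext g
    rw [mem_Mon, Finset.mem_singleton]
    constructor
    · rintro ⟨h1, h2⟩; exact h1.natDegree_eq_zero.1 h2
    · rintro rfl; exact ⟨monic_one, natDegree_one⟩
  rw [LS, this, Finset.sum_singleton, lam_one]

lemma LS_one (ψ : AddChar F ℂ) (u : F) :
    LS ψ u 1 = ∑ x : F, if x = 0 then 0 else ψ (x + u * x⁻¹) := by
  rw [LS]
  symm
  refine Finset.sum_bij (fun x _ => X - C x) ?_ ?_ ?_ ?_
  · intro x _
    exact mem_Mon.2 ⟨monic_X_sub_C x, natDegree_X_sub_C x⟩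
  · intro a _ b _ h
    simpa using h
  · intro g hg
    obtain ⟨h1, h2⟩ := mem_Mon.1 hg
    refine ⟨-g.coeff 0, Finset.mem_univ _, ?_⟩
    rw [h1.eq_X_add_C h2]; simp
  · intro x _
    have h3 : (X - C x : F[X]).nextCoeff = -x := nextCoeff_X_sub_C x
    simp only [lam, h3]
    simp [coeff_X, coeff_C]

lemma LS_big (ψ : AddChar F ℂ) (hψ : ψ ≠ 1) (u : F) (n : ℕ) (hn : 3 ≤ n) : LS ψ u n = 0 := by
  obtain ⟨t, ht⟩ : ∃ t, ψ t ≠ 1 := by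
    by_contra hcon
    push Not at hcon
    exact hψ (by ext t; simpa using hcon t)
  have hmem : ∀ t : F, ∀ g ∈ Mon F n, g - C t * X ^ (n - 1) ∈ Mon F n := by
    intro t g hg
    obtain ⟨h1, h2⟩ := mem_Mon.1 hg
    have hlt : (C t * X ^ (n - 1)).degree < g.degree := by
      rw [degree_eq_natDegree h1.ne_zero, h2]
      refine (degree_C_mul_X_pow_le _ _).trans_lt ?_
      exact_mod_cast (by omega)
    refine mem_Mon.2 ⟨h1.sub_of_left hlt, ?_⟩
    rw [natDegree_sub_eq_left_of_natDegree_lt, h2]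
    exact (natDegree_C_mul_X_pow_le _ _).trans_lt (by omega)
  have key : LS ψ u n = ψ t * LS ψ u n := by
    conv_lhs => rw [LS]
    rw [LS, Finset.mul_sum]
    symm
    refine Finset.sum_bij (fun g _ => g - C t * X ^ (n - 1)) ?_ ?_ ?_ ?_
    · exact fun g hg => hmem t g hg
    · intro a _ b _ h
      simpa using h
    · intro g hg
      refine ⟨g - C (-t) * X ^ (n - 1), hmem _ g hg, ?_⟩
      simp
    · intro g hg
      have h3 := hmem t g hg
      obtain ⟨h1, h2⟩ := mem_Mon.1 hg
      obtain ⟨h4, h5⟩ := mem_Mon.1 h3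
      have c0 : (g - C t * X ^ (n - 1)).coeff 0 = g.coeff 0 := by
        rw [coeff_sub, coeff_C_mul_X_pow, if_neg (by omega), sub_zero]
      have c1 : (g - C t * X ^ (n - 1)).coeff 1 = g.coeff 1 := by
        rw [coeff_sub, coeff_C_mul_X_pow, if_neg (by omega), sub_zero]
      have cn : (g - C t * X ^ (n - 1)).nextCoeff = g.nextCoeff - t := by
        rw [nextCoeff_of_natDegree_pos (by omega), nextCoeff_of_natDegree_pos (by omega), h2, h5]
        simp
      rw [lam, lam, c0, c1, cn]
      split_ifs
      · simp
      · rw [← AddChar.map_add_eq_mul]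
        congr 1; ring
  have : (ψ t - 1) * LS ψ u n = 0 := by linear_combination -key
  exact (mul_eq_zero.1 this).resolve_left (sub_ne_zero.2 ht)

lemma sum_char_mul (ψ : AddChar F ℂ) (hψ : ψ ≠ 1) (b : F) :
    ∑ a : F, ψ (a * b) = if b = 0 then (Fintype.card F : ℂ) else 0 := by
  have := AddChar.sum_mulShift b (AddChar.IsPrimitive.of_ne_one hψ)
  simpa using this

lemma LS_two (ψ : AddChar F ℂ) (hψ : ψ ≠ 1) (u : F) (hu : u ≠ 0) :
    LS ψ u 2 = Fintype.card F := by
  have h1 : LS ψ u 2 = ∑ p : F × F, if p.2 = 0 then 0 else ψ (p.1 * (-1 - u / p.2)) := by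
    rw [LS]
    symm
    have hdeg : ∀ p : F × F, (C p.1 * X + C p.2 : F[X]).degree < (2 : ℕ) := fun p =>
      degree_linear_lt.trans_eq rfl
    have hnd : ∀ p : F × F, (X ^ 2 + (C p.1 * X + C p.2) : F[X]).natDegree = 2 := fun p => by
      rw [natDegree_add_eq_left_of_degree_lt]
      · simp
      · rw [degree_X_pow]; exact hdeg p
    refine Finset.sum_bij (fun p _ => X ^ 2 + (C p.1 * X + C p.2)) ?_ ?_ ?_ ?_
    · intro p _
      exact mem_Mon.2 ⟨monic_X_pow_add (hdeg p), hnd p⟩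
    · intro a _ b _ h
      have e0 := congrArg (fun g => coeff g 0) h
      have e1 := congrArg (fun g => coeff g 1) h
      simp [coeff_X, coeff_C] at e0 e1
      exact Prod.ext e1 e0
    · intro g hg
      obtain ⟨h1, h2⟩ := mem_Mon.1 hg
      refine ⟨(g.coeff 1, g.coeff 0), Finset.mem_univ _, ?_⟩
      have h3 := g.as_sum_range_C_mul_X_pow
      have h4 : g.coeff 2 = 1 := by rw [← h2]; exact h1.coeff_natDegree
      conv_rhs => rw [h3, h2]
      simp [Finset.sum_range_succ, h4]
      ring
    · intro p _
      have c0 : (X ^ 2 + (C p.1 * X + C p.2) : F[X]).coeff 0 = p.2 := by simp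
      have c1 : (X ^ 2 + (C p.1 * X + C p.2) : F[X]).coeff 1 = p.1 := by simp [coeff_X, coeff_C, coeff_X_pow]
      rw [lam, nextCoeff_of_natDegree_pos (by rw [hnd]; norm_num), hnd, c0, c1]
      split_ifs
      · rfl
      · congr 1; ring
  rw [h1, Fintype.sum_prod_type_right]
  have h2 : ∀ y : F, (∑ x : F, if y = 0 then 0 else ψ (x * (-1 - u / y))) =
      if y = -u then (Fintype.card F : ℂ) else 0 := by
    intro y
    by_cases hy : y = 0
    · subst hy
      have : ¬ (0 : F) = -u := fun h => hu (by simpa using h.symm)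
      simp [this]
    · simp only [hy, if_false]
      rw [sum_char_mul ψ hψ]
      congr 1
      rw [eq_iff_iff, sub_eq_zero, eq_div_iff hy]
      constructor
      · intro h; linear_combination -h
      · intro h; rw [h]; ring
  rw [Finset.sum_congr rfl (fun y _ => h2 y)]
  simp

theorem LV_rec (ψ : AddChar F ℂ) (hψ : ψ ≠ 1) (u : F) (hu : u ≠ 0) :
    LV ψ u 1 = LS ψ u 1 ∧ LV ψ u 2 = 2 * Fintype.card F - LS ψ u 1 ^ 2 ∧
    ∀ n, 1 ≤ n → LV ψ u (n + 2) = - LS ψ u 1 * LV ψ u (n + 1) - Fintype.card F * LV ψ u n := by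
  have n1 := newton ψ u 1
  have n2 := newton ψ u 2
  have e2 : Finset.Icc 1 2 = {1, 2} := rfl
  rw [e2] at n2
  simp [LS_zero, LS_two ψ hψ u hu] at n1 n2
  refine ⟨n1.symm, ?_, ?_⟩
  · rw [← n1] at n2; linear_combination -n2
  · intro n hn
    have h := newton ψ u (n + 2)
    rw [LS_big ψ hψ u (n + 2) (by omega), mul_zero] at h
    rw [Finset.sum_Icc_succ_top (by omega), Finset.sum_Icc_succ_top (by omega)] at h
    obtain ⟨n, rfl⟩ : ∃ k, n = k + 1 := ⟨n - 1, by omega⟩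
    rw [Finset.sum_Icc_succ_top (by omega)] at h
    rw [Finset.sum_eq_zero] at h
    · simp only [Nat.sub_self, LS_zero] at h
      rw [show n + 1 + 2 - (n + 1) = 2 by omega, show n + 1 + 2 - (n + 1 + 1) = 1 by omega,
        LS_two ψ hψ u hu] at h
      linear_combination -h
    · intro k hk
      rw [Finset.mem_Icc] at hk
      rw [LS_big ψ hψ u _ (by omega), mul_zero]

end LVals

section FieldId
variable {F : Type} [Field F] [Fintype F]
variable {K : Type} [Field K] [Fintype K] [DecidableEq K] [Algebra F K]

lemma minpoly_inv_nextCoeff (x : K) (hx : x ≠ 0) :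
    (minpoly F x⁻¹).nextCoeff = (minpoly F x).coeff 1 / (minpoly F x).coeff 0 := by
  have hint : ∀ x : K, IsIntegral F x := fun x => .of_finite F x
  have hc0 : ∀ x : K, x ≠ 0 → (minpoly F x).coeff 0 ≠ 0 := fun x hx =>
    minpoly.coeff_zero_ne_zero (hint x) hx
  have hroot : ∀ x : K, x ≠ 0 → aeval x⁻¹ (minpoly F x).reverse = 0 := by
    intro x hx
    letI : Invertible x := invertibleOfNonzero hx
    have := (eval₂_reverse_eq_zero_iff (algebraMap F K) x (minpoly F x)).2 (minpoly.aeval F x)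
    rwa [invOf_eq_inv] at this
  have hrev0 : ∀ x : K, (minpoly F x).reverse ≠ 0 := fun x => by
    rw [Ne, reverse_eq_zero]; exact minpoly.ne_zero (hint x)
  have hle : ∀ x : K, x ≠ 0 → (minpoly F x⁻¹).natDegree ≤ (minpoly F x).natDegree := fun x hx =>
    (natDegree_le_of_dvd (minpoly.dvd F _ (hroot x hx)) (hrev0 x)).trans (reverse_natDegree_le _)
  have hdeg : (minpoly F x⁻¹).natDegree = (minpoly F x).natDegree := by
    refine le_antisymm (hle x hx) ?_
    have := hle x⁻¹ (inv_ne_zero hx)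
    rwa [inv_inv] at this
  have hrd : (minpoly F x).reverse.natDegree = (minpoly F x).natDegree := by
    refine le_antisymm (reverse_natDegree_le _) ?_
    rw [← hdeg]
    exact natDegree_le_of_dvd (minpoly.dvd F _ (hroot x hx)) (hrev0 x)
  have hpos : 0 < (minpoly F x).natDegree := minpoly.natDegree_pos (hint x)
  obtain ⟨g, hg⟩ := minpoly.dvd F _ (hroot x hx)
  have hg0 : g ≠ 0 := by rintro rfl; simp at hg; exact minpoly.ne_zero (hint x) hg
  have hgd : g.natDegree = 0 := by
    have := congrArg natDegree hg
    rw [natDegree_mul (minpoly.ne_zero (hint _)) hg0] at this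
    omega
  rw [eq_C_of_natDegree_eq_zero hgd] at hg
  set a := g.coeff 0
  have e0 := congrArg (fun p => p.coeff (minpoly F x).natDegree) hg
  have e1 := congrArg (fun p => p.coeff ((minpoly F x).natDegree - 1)) hg
  simp only [coeff_reverse, coeff_mul_C] at e0 e1
  rw [revAt_le le_rfl, Nat.sub_self] at e0
  rw [revAt_le (by omega), show (minpoly F x).natDegree - ((minpoly F x).natDegree - 1) = 1 by omega] at e1
  have hlead : (minpoly F x⁻¹).coeff (minpoly F x).natDegree = 1 := by
    rw [← hdeg]; exact (minpoly.monic (hint _)).coeff_natDegree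
  rw [hlead, one_mul] at e0
  rw [nextCoeff_of_natDegree_pos (by omega), hdeg, e1, e0]
  have := hc0 x hx
  rw [e0] at this
  field_simp

noncomputable def trSum (K : Type) [Field K] [Fintype K] [DecidableEq K] [Algebra F K]
    (ψ : AddChar F ℂ) (u : F) : ℂ :=
  ∑ x : K, if x = 0 then 0 else ψ (Algebra.trace F K (x + algebraMap F K u * x⁻¹))

lemma term_eq (ψ : AddChar F ℂ) (u : F) (x : K) (j : ℕ) (hj1 : 1 ≤ j)
    (hj : j * (minpoly F x).natDegree = Module.finrank F K) :
    (if x = 0 then 0 else ψ (Algebra.trace F K (x + algebraMap F K u * x⁻¹))) =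
      lam ψ u (minpoly F x) ^ j := by
  have hint : ∀ x : K, IsIntegral F x := fun x => .of_finite F x
  by_cases hx : x = 0
  · subst hx
    rw [if_pos rfl, minpoly.zero, lam, if_pos (by simp), zero_pow (by omega)]
  rw [if_neg hx, lam, if_neg (minpoly.coeff_zero_ne_zero (hint x) hx)]
  have hfr : ∀ y : K, (minpoly F y).natDegree = (minpoly F x).natDegree → 
      Module.finrank (IntermediateField.adjoin F {y}) K = j := by
    intro y hy
    have h1 := Module.finrank_mul_finrank F (IntermediateField.adjoin F {y}) K
    rw [IntermediateField.adjoin.finrank (hint y), hy, ← hj, mul_comm] at h1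
    exact Nat.eq_of_mul_eq_mul_right (minpoly.natDegree_pos (hint x)) h1
  have hfr2 : Module.finrank (IntermediateField.adjoin F {x⁻¹}) K = j := by
    have : IntermediateField.adjoin F {x⁻¹} = IntermediateField.adjoin F {x} := by
      apply le_antisymm
      · rw [IntermediateField.adjoin_simple_le_iff]
        exact inv_mem (IntermediateField.mem_adjoin_simple_self F x)
      · rw [IntermediateField.adjoin_simple_le_iff]
        have := inv_mem (IntermediateField.mem_adjoin_simple_self F x⁻¹)
        rwa [inv_inv] at this
    rw [this]; exact hfr x rfl
  rw [map_add, ← Algebra.smul_def, map_smul, trace_eq_finrank_mul_minpoly_nextCoeff F x,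
    trace_eq_finrank_mul_minpoly_nextCoeff F x⁻¹, hfr x rfl, hfr2, minpoly_inv_nextCoeff x hx,
    ← AddChar.map_nsmul_eq_pow]
  congr 1
  rw [nsmul_eq_mul, smul_eq_mul]
  ring

theorem trSum_eq (ψ : AddChar F ℂ) (u : F) :
    trSum K ψ u = LV ψ u (Module.finrank F K) := by
  classical
  set k := Module.finrank F K with hk
  have hk0 : 0 < k := Module.finrank_pos
  have hint : ∀ x : K, IsIntegral F x := fun x => .of_finite F x
  have hdv : ∀ x : K, (minpoly F x).natDegree ∣ k := fun x => minpoly.degree_dvd (hint x)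
  have hmaps : ∀ x ∈ (Finset.univ : Finset K), minpoly F x ∈ Irr F k := fun x _ =>
    mem_Irr.2 ⟨minpoly.monic (hint x), Nat.le_of_dvd hk0 (hdv x), minpoly.irreducible (hint x)⟩
  rw [trSum, LV, ← Finset.sum_fiberwise_of_maps_to hmaps]
  refine Finset.sum_congr rfl fun P hP => ?_
  obtain ⟨hm, hle, hi⟩ := mem_Irr.1 hP
  have hpos := hi.natDegree_pos
  by_cases hd : P.natDegree ∣ k
  · obtain ⟨j, hj⟩ := hd
    have hj1 : 1 ≤ j := by
      rcases Nat.eq_zero_or_pos j with h | h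
      · subst h; omega
      · exact h
    have hjk : j ≤ k := by rw [hj]; exact Nat.le_mul_of_pos_left _ hpos
    rw [Finset.sum_eq_single j]
    · rw [if_pos (by rw [hj, mul_comm])]
      have h1 : ∀ x ∈ Finset.univ.filter (fun x : K => minpoly F x = P),
          (if x = 0 then 0 else ψ (Algebra.trace F K (x + algebraMap F K u * x⁻¹))) = lam ψ u P ^ j := by
        intro x hx
        rw [Finset.mem_filter] at hx
        rw [term_eq ψ u x j hj1 (by rw [hx.2, ← hk, hj, mul_comm]), hx.2]
      rw [Finset.sum_congr rfl h1, Finset.sum_const, nsmul_eq_mul]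
      congr 2
      -- count roots
      have hroot : ∃ x : K, aeval x P = 0 := by
        haveI : Fact (Irreducible P) := ⟨hi⟩
        have hfd : Module.finrank F (AdjoinRoot P) = P.natDegree := by
          rw [(AdjoinRoot.powerBasis hi.ne_zero).finrank, AdjoinRoot.powerBasis_dim]
        obtain ⟨φ⟩ := FiniteField.nonempty_algHom_of_finrank_dvd (F := F) (K := AdjoinRoot P) (L := K)
          (by rw [hfd, ← hk, hj]; exact dvd_mul_right _ _)
        refine ⟨φ (AdjoinRoot.root P), ?_⟩
        rw [aeval_algHom_apply]
        simp
      obtain ⟨x0, hx0⟩ := hroot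
      have hmin : minpoly F x0 = P := (minpoly.eq_of_irreducible_of_monic hi hx0 hm).symm
      have hspl : (P.map (algebraMap F K)).Splits := by
        rw [← hmin]; exact Normal.splits inferInstance x0
      have hsep : P.Separable := PerfectField.separable_of_irreducible hi
      have hcard := card_rootSet_eq_natDegree hsep hspl
      rw [← hcard, ← Set.toFinset_card]
      congr 1
      ext x
      simp only [Finset.mem_filter, Finset.mem_univ, true_and, Set.mem_toFinset, mem_rootSet]
      constructor
      · intro h; exact ⟨hi.ne_zero, h ▸ minpoly.aeval F x⟩
      · rintro ⟨_, h⟩; exact (minpoly.eq_of_irreducible_of_monic hi h hm).symm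
    · intro i _ hij
      rw [if_neg]
      intro h
      apply hij
      rw [hj, mul_comm] at h
      exact Nat.eq_of_mul_eq_mul_left hpos h
    · intro h; exact absurd (Finset.mem_Icc.2 ⟨hj1, hjk⟩) h
  · rw [Finset.filter_false_of_mem, Finset.sum_empty]
    · symm
      refine Finset.sum_eq_zero fun j _ => ?_
      rw [if_neg]
      intro h
      exact hd ⟨j, by rw [← h, mul_comm]⟩
    · intro x _ h
      exact hd (h ▸ hdv x)

end FieldId
end

lemma growth_real (κ Q C : ℝ) (hQ : 0 < Q) (L : ℕ → ℝ) (h1 : L 1 = κ) (h2 : L 2 = 2 * Q - κ ^ 2)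
    (hrec : ∀ n, 1 ≤ n → L (n + 2) = - κ * L (n + 1) - Q * L n)
    (hb : ∀ m, 4 ≤ m → - L (2 * m) ≤ C * Q ^ m) : κ ^ 2 ≤ 4 * Q := by
  by_contra hcon
  push Not at hcon
  obtain ⟨r, hr⟩ : ∃ r : ℝ, r ^ 2 = κ ^ 2 - 4 * Q :=
    ⟨Real.sqrt (κ ^ 2 - 4 * Q), Real.sq_sqrt (by linarith)⟩
  have key : ∀ α β : ℝ, α + β = -κ → α * β = Q → α ^ 2 ≤ Q := by
    intro α β hs hp
    have hL : ∀ n, L (n + 1) = - (α ^ (n + 1) + β ^ (n + 1)) ∧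
        L (n + 2) = - (α ^ (n + 2) + β ^ (n + 2)) := by
      intro n
      induction n with
      | zero =>
        refine ⟨by rw [h1]; linear_combination hs, ?_⟩
        rw [h2, ← hp]
        have : κ = -(α + β) := by linarith
        rw [this]; ring
      | succ n ih =>
        refine ⟨ih.2, ?_⟩
        rw [hrec (n + 1) (by omega), ih.1, show n + 1 + 1 = n + 2 by rfl, ih.2, ← hp]
        have : κ = -(α + β) := by linarith
        rw [this]; ring
    by_contra hlt
    push Not at hlt
    have hgt : 1 < α ^ 2 / Q := by rwa [one_lt_div hQ]
    obtain ⟨m, hm⟩ := pow_unbounded_of_one_lt C hgt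
    have h4 : (α ^ 2 / Q) ^ m ≤ (α ^ 2 / Q) ^ (m + 4) := pow_le_pow_right₀ hgt.le (by omega)
    have h5 := hb (m + 4) (by omega)
    have h6 := (hL (2 * (m + 4) - 1)).1
    rw [show 2 * (m + 4) - 1 + 1 = 2 * (m + 4) by omega] at h6
    rw [h6, neg_neg, pow_mul, pow_mul] at h5
    have h7 : 0 ≤ (β ^ 2) ^ (m + 4) := by positivity
    have h8 : (α ^ 2 / Q) ^ (m + 4) ≤ C := by
      rw [div_pow, div_le_iff₀ (by positivity)]; linarith
    linarith
  have a := key ((-κ + r) / 2) ((-κ - r) / 2) (by ring) (by linear_combination -hr / 4)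
  have b := key ((-κ - r) / 2) ((-κ + r) / 2) (by ring) (by linear_combination -hr / 4)
  nlinarith

section Kl
variable {F : Type} [Field F] [Fintype F] [DecidableEq F]

lemma LS_one_conj (ψ : AddChar F ℂ) (u : F) :
    (starRingEnd ℂ) (LS ψ u 1) = LS ψ u 1 := by
  rw [LS_one, map_sum]
  refine Fintype.sum_equiv (Equiv.neg F) _ _ fun x => ?_
  simp only [Equiv.neg_apply, neg_eq_zero]
  split_ifs
  · simp
  · rw [← AddChar.map_neg_eq_conj, inv_neg]
    congr 1; ring

lemma LV_real (ψ : AddChar F ℂ) (hψ : ψ ≠ 1) (u : F) (hu : u ≠ 0) (n : ℕ) :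
    LV ψ u (n + 1) = ((LV ψ u (n + 1)).re : ℂ) ∧ LV ψ u (n + 2) = ((LV ψ u (n + 2)).re : ℂ) := by
  obtain ⟨h1, h2, h3⟩ := LV_rec ψ hψ u hu
  have hc := LS_one_conj ψ u
  simp only [eq_comm (a := LV ψ u _), ← Complex.conj_eq_iff_re]
  induction n with
  | zero =>
    rw [zero_add, zero_add, h1, h2]
    refine ⟨hc, ?_⟩
    simp [hc, Complex.conj_ofNat]
  | succ n ih =>
    refine ⟨ih.2, ?_⟩
    rw [h3 _ (by omega)]
    have := ih.2
    rw [show n + 1 + 1 = n + 2 by rfl]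
    simp [hc, ih.1, ih.2]

lemma LV_double (ψ : AddChar F ℂ) (hψ : ψ ≠ 1) (u : F) (hu : u ≠ 0) (m : ℕ) (hm : 1 ≤ m) :
    LV ψ u (2 * m) = 2 * (Fintype.card F : ℂ) ^ m - LV ψ u m ^ 2 := by
  obtain ⟨h1, h2, h3⟩ := LV_rec ψ hψ u hu
  obtain ⟨r, hr⟩ : ∃ r : ℂ, r ^ 2 = LS ψ u 1 ^ 2 - 4 * Fintype.card F :=
    ⟨_, Complex.cpow_nat_inv_pow _ (n := 2) (by norm_num)⟩
  set κ := LS ψ u 1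
  set α := (-κ + r) / 2 with hα
  set β := (-κ - r) / 2 with hβ
  have hs : κ = - (α + β) := by rw [hα, hβ]; ring
  have hp : (Fintype.card F : ℂ) = α * β := by rw [hα, hβ]; linear_combination hr / 4
  have hL : ∀ n, LV ψ u (n + 1) = - (α ^ (n + 1) + β ^ (n + 1)) ∧
        LV ψ u (n + 2) = - (α ^ (n + 2) + β ^ (n + 2)) := by
    intro n
    induction n with
    | zero =>
      refine ⟨by rw [zero_add, h1, hs]; ring, ?_⟩
      rw [zero_add, h2, hp, hs]; ring
    | succ n ih =>
      refine ⟨ih.2, ?_⟩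
      rw [h3 (n + 1) (by omega), ih.1, show n + 1 + 1 = n + 2 by rfl, ih.2, hp, hs]; ring
  have e1 := (hL (m - 1)).1
  have e2 := (hL (2 * m - 1)).1
  rw [show m - 1 + 1 = m by omega] at e1
  rw [show 2 * m - 1 + 1 = 2 * m by omega] at e2
  rw [e1, e2, hp, mul_pow]; ring

lemma mulShift_ne_one (ψ : AddChar F ℂ) (hψ : ψ ≠ 1) (c : F) (hc : c ≠ 0) :
    AddChar.mulShift ψ c ≠ 1 := AddChar.IsPrimitive.of_ne_one hψ hc

lemma LV_sum (ψ : AddChar F ℂ) (hψ : ψ ≠ 1) (u : F) (hu : u ≠ 0) (hodd : Odd (Fintype.card F))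
    (m : ℕ) (hm : 4 ≤ m) :
    -((10 * (Fintype.card F : ℝ) + 4) * (Fintype.card F : ℝ) ^ m) ≤
      ∑ c ∈ Finset.univ.erase (0 : F), (LV (AddChar.mulShift ψ c) u (2 * m)).re := by
  classical
  obtain ⟨p, hp⟩ := CharP.exists F
  haveI : Fact p.Prime := ⟨CharP.char_is_prime F p⟩
  haveI : NeZero (2 * m) := ⟨by omega⟩
  let K := FiniteField.Extension F p (2 * m)
  haveI : Finite K := Module.finite_of_finite F
  letI : Fintype K := Fintype.ofFinite K
  set q := Fintype.card F with hq
  have hK : Fintype.card K = (q ^ m) ^ 2 := by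
    rw [← Nat.card_eq_fintype_card, FiniteField.natCard_extension, Nat.card_eq_fintype_card, ← hq,
      ← pow_mul, mul_comm]
  have hfr : Module.finrank F K = 2 * m := FiniteField.finrank_extension F p (2 * m)
  have h2 : (2 : F) ≠ 0 := Ring.two_ne_zero (by
    intro h
    have := FiniteField.even_card_of_char_two h
    rw [← hq] at this
    rw [Nat.odd_iff] at hodd
    omega)
  obtain ⟨h, hs⟩ := hodd.pow (n := m)
  have hq3 : 3 ≤ q := by
    have : 1 < q := hq ▸ Fintype.one_lt_card
    rcases hodd with ⟨k, hk⟩; omega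
  have hh : q ^ 2 + 3 * q + 1 < h := by
    have h4 : q ^ 4 ≤ q ^ m := Nat.pow_le_pow_right (by omega) hm
    have h9 : 9 * q ^ 2 ≤ q ^ 4 := by
      have : 9 ≤ q ^ 2 := by nlinarith
      calc 9 * q ^ 2 ≤ q ^ 2 * q ^ 2 := Nat.mul_le_mul_right _ this
        _ = q ^ 4 := by ring
    nlinarith
  have hcount := count_lower (K := K) q m h hq.symm hs h2 hK hh u hu
  set N0 := (Finset.univ.filter (fun x : K => x ≠ 0 ∧
    Algebra.trace F K (x + algebraMap F K u * x⁻¹) = 0)).card with hN0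
  have htot : ∑ c : F, trSum K (AddChar.mulShift ψ c) u = (q : ℂ) * N0 := by
    simp only [trSum, AddChar.mulShift_apply]
    rw [Finset.sum_comm]
    have : ∀ x : K, (∑ c : F, if x = 0 then 0 else
        ψ (c * Algebra.trace F K (x + algebraMap F K u * x⁻¹))) =
        if x ≠ 0 ∧ Algebra.trace F K (x + algebraMap F K u * x⁻¹) = 0 then (q : ℂ) else 0 := by
      intro x
      by_cases hx : x = 0
      · simp [hx]
      · simp only [hx, if_false, sum_char_mul ψ hψ, ne_eq, not_false_eq_true, true_and, hq]
    rw [Finset.sum_congr rfl (fun x _ => this x), ← Finset.sum_filter, Finset.sum_const,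
      nsmul_eq_mul, mul_comm]
  have hzero : trSum K (AddChar.mulShift ψ (0 : F)) u = (q : ℂ) ^ m ^ 1 * (q : ℂ) ^ m - 1 := by
    simp only [trSum, AddChar.mulShift_apply, zero_mul, AddChar.map_zero_eq_one]
    have : ∀ x : K, (if x = 0 then (0 : ℂ) else 1) = 1 - if x = 0 then 1 else 0 := by
      intro x; split_ifs <;> simp
    simp only [this, Finset.sum_sub_distrib]
    simp only [Finset.sum_const, Finset.card_univ, hK, Finset.sum_ite_eq', Finset.mem_univ, if_true]
    simp
    ring
  have hsplit := Finset.add_sum_erase Finset.univ (fun c : F => trSum K (AddChar.mulShift ψ c) u)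
    (Finset.mem_univ 0)
  rw [htot, hzero] at hsplit
  have hre := congrArg Complex.re hsplit
  have hcast : ((q : ℂ) ^ m ^ 1 * (q : ℂ) ^ m - 1 ).re = (q : ℝ) ^ m * (q : ℝ) ^ m - 1 := by
    rw [pow_one]
    have : (q : ℂ) ^ m * (q : ℂ) ^ m - 1 = (((q : ℝ) ^ m * (q : ℝ) ^ m - 1 : ℝ) : ℂ) := by
      push_cast; ring
    rw [this, Complex.ofReal_re]
  have hcast2 : ((q : ℂ) * N0).re = (q : ℝ) * N0 := by
    have : (q : ℂ) * N0 = (((q : ℝ) * N0 : ℝ) : ℂ) := by push_cast; ring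
    rw [this, Complex.ofReal_re]
  rw [Complex.add_re, hcast, hcast2, Complex.re_sum] at hre
  simp only [trSum_eq, hfr] at hre
  have hcR : (2 * (q ^ m) ^ 2 : ℝ) ≤ q * N0 + 2 * (h + q ^ m * (h + q + 2) + q * (q ^ m + 1)) + 4 * q := by
    exact_mod_cast hcount
  have hsR : (q : ℝ) ^ m = 2 * h + 1 := by exact_mod_cast hs
  have hqR : (3 : ℝ) ≤ q := by exact_mod_cast hq3
  have hs1 : (1 : ℝ) ≤ (q : ℝ) ^ m := one_le_pow₀ (by linarith)
  set s := (q : ℝ) ^ m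
  have hh' : (h : ℝ) = (s - 1) / 2 := by linarith
  rw [hh'] at hcR
  nlinarith

/-- Weil bound for Kloosterman sums. -/
theorem kloosterman_bound (ψ : AddChar F ℂ) (hψ : ψ ≠ 1) (u : F) (hu : u ≠ 0)
    (hodd : Odd (Fintype.card F)) :
    ‖∑ x : F, if x = 0 then (0 : ℂ) else ψ (x + u * x⁻¹)‖ ≤ 2 * Real.sqrt (Fintype.card F) := by
  rw [← LS_one]
  set q := Fintype.card F with hq
  have hq0 : (0 : ℝ) < q := by exact_mod_cast Fintype.card_pos
  obtain ⟨h1, h2, h3⟩ := LV_rec ψ hψ u hu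
  have hκ : LS ψ u 1 = ((LS ψ u 1).re : ℂ) := (Complex.conj_eq_iff_re.1 (LS_one_conj ψ u)).symm
  set κ := (LS ψ u 1).re with hκd
  have hdbl : ∀ c : F, c ≠ 0 → ∀ m, 1 ≤ m →
      (LV (AddChar.mulShift ψ c) u (2 * m)).re ≤ 2 * (q : ℝ) ^ m := by
    intro c hc m hm
    have hc1 := mulShift_ne_one ψ hψ c hc
    have e1 := LV_double _ hc1 u hu m hm
    have e2 := (LV_real _ hc1 u hu (m - 1)).1
    rw [show m - 1 + 1 = m by omega] at e2
    rw [e2] at e1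
    set t := (LV (AddChar.mulShift ψ c) u m).re
    have e3 : LV (AddChar.mulShift ψ c) u (2 * m) = ((2 * (q : ℝ) ^ m - t ^ 2 : ℝ) : ℂ) := by
      rw [e1]; push_cast; rfl
    rw [e3, Complex.ofReal_re]
    nlinarith [sq_nonneg t]
  have hone : AddChar.mulShift ψ (1 : F) = ψ := AddChar.mulShift_one ψ
  have hfin : κ ^ 2 ≤ 4 * q := by
    refine growth_real κ q (12 * q + 4) hq0 (fun n => (LV ψ u n).re) ?_ ?_ ?_ ?_
    · simp only [h1, hκd]
    · simp only [h2]
      rw [hκ]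
      have : (2 * (q : ℂ) - (κ : ℂ) ^ 2) = ((2 * q - κ ^ 2 : ℝ) : ℂ) := by push_cast; rfl
      rw [this, Complex.ofReal_re]
    · intro n hn
      simp only [h3 n hn]
      rw [hκ]
      have : -(κ : ℂ) = ((-κ : ℝ) : ℂ) := by push_cast; rfl
      rw [this, Complex.sub_re, Complex.re_ofReal_mul]
      have : (q : ℂ) = ((q : ℝ) : ℂ) := by push_cast; rfl
      rw [this, Complex.re_ofReal_mul]
    · intro m hm
      have hsum := LV_sum ψ hψ u hu hodd m hm
      rw [← Finset.add_sum_erase _ _ (Finset.mem_erase.2 ⟨one_ne_zero, Finset.mem_univ (1 : F)⟩),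
        hone] at hsum
      have hb : ∑ c ∈ (Finset.univ.erase (0 : F)).erase 1, (LV (AddChar.mulShift ψ c) u (2 * m)).re
          ≤ ∑ c ∈ (Finset.univ.erase (0 : F)).erase 1, 2 * (q : ℝ) ^ m := by
        refine Finset.sum_le_sum fun c hc => hdbl c ?_ m (by omega)
        exact (Finset.mem_erase.1 (Finset.mem_erase.1 hc).2).1
      have hb2 : ∑ c ∈ (Finset.univ.erase (0 : F)).erase 1, 2 * (q : ℝ) ^ m ≤ ∑ c : F, 2 * (q : ℝ) ^ m :=
        Finset.sum_le_sum_of_subset_of_nonneg (Finset.subset_univ _) (fun _ _ _ => by positivity)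
      rw [Finset.sum_const (s := Finset.univ), Finset.card_univ, nsmul_eq_mul, ← hq] at hb2
      rw [← hq] at hsum
      show -(LV ψ u (2 * m)).re ≤ _
      nlinarith
  rw [hκ, Complex.norm_real, Real.norm_eq_abs]
  have : |κ| = Real.sqrt (κ ^ 2) := (Real.sqrt_sq_eq_abs κ).symm
  rw [this]
  calc Real.sqrt (κ ^ 2) ≤ Real.sqrt (4 * q) := Real.sqrt_le_sqrt hfin
    _ = 2 * Real.sqrt q := by
      rw [Real.sqrt_mul (by norm_num), show (4 : ℝ) = 2 ^ 2 by norm_num, Real.sqrt_sq (by norm_num)]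

end Kl

section Gauss
variable {F : Type} [Field F] [Fintype F] [DecidableEq F]

noncomputable def qchi (s : F) : ℂ := ((quadraticChar F s : ℤ) : ℂ)

lemma qchi_mul (a b : F) : qchi (a * b) = qchi a * qchi b := by
  rw [qchi, map_mul, Int.cast_mul]; rfl

lemma qchi_sq (a : F) (ha : a ≠ 0) : qchi a ^ 2 = 1 := by
  have := quadraticChar_sq_one ha
  unfold qchi
  exact_mod_cast this

lemma qchi_norm (a : F) (ha : a ≠ 0) : ‖qchi a‖ = 1 := by
  have h := congrArg norm (qchi_sq a ha)
  rw [norm_pow, norm_one] at h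
  exact (pow_eq_one_iff_of_nonneg (norm_nonneg _) (by norm_num)).1 h

lemma qchi_inv (a : F) (ha : a ≠ 0) : qchi a⁻¹ = qchi a := by
  have h1 : qchi a * qchi a⁻¹ = 1 := by
    rw [← qchi_mul, mul_inv_cancel₀ ha]; simp [qchi]
  have h2 := qchi_sq a ha
  linear_combination qchi a * h1 - qchi a⁻¹ * h2

noncomputable def qg (ψ : AddChar F ℂ) (s : F) : ℂ := ∑ y : F, ψ (s * y ^ 2)

lemma sum_char_mul' (ψ : AddChar F ℂ) (hψ : ψ ≠ 1) (b : F) :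
    ∑ a : F, ψ (b * a) = if b = 0 then (Fintype.card F : ℂ) else 0 := by
  rw [← sum_char_mul ψ hψ]
  exact Finset.sum_congr rfl fun a _ => by rw [mul_comm]

lemma qg_eq (ψ : AddChar F ℂ) (hψ : ψ ≠ 1) (h2 : ringChar F ≠ 2) (s : F) (hs : s ≠ 0) :
    qg ψ s = ∑ a : F, qchi a * ψ (s * a) := by
  have h1 : qg ψ s = ∑ a : F, (qchi a + 1) * ψ (s * a) := by
    rw [qg, ← Finset.sum_fiberwise_of_maps_to (t := Finset.univ) (g := fun y : F => y ^ 2)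
      (fun _ _ => Finset.mem_univ _)]
    refine Finset.sum_congr rfl fun a _ => ?_
    have hc := quadraticChar_card_sqrts h2 a
    rw [Finset.sum_congr rfl (g := fun _ => ψ (s * a))
      (fun y hy => by rw [(Finset.mem_filter.1 hy).2]), Finset.sum_const, nsmul_eq_mul]
    congr 1
    have : (Finset.univ.filter (fun y : F => y ^ 2 = a)) = {x : F | x ^ 2 = a}.toFinset := by
      ext; simp
    rw [this, qchi]
    exact_mod_cast hc
  rw [h1]
  simp only [add_mul, one_mul, Finset.sum_add_distrib]
  rw [sum_char_mul' ψ hψ, if_neg hs, add_zero]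

lemma qg_chi (ψ : AddChar F ℂ) (hψ : ψ ≠ 1) (h2 : ringChar F ≠ 2) (s : F) (hs : s ≠ 0) :
    qg ψ s = qchi s * qg ψ 1 := by
  rw [qg_eq ψ hψ h2 s hs, qg_eq ψ hψ h2 1 one_ne_zero, Finset.mul_sum]
  refine Fintype.sum_equiv (Equiv.mulLeft₀ s hs) _ _ fun a => ?_
  simp only [Equiv.mulLeft₀_apply, one_mul]
  rw [qchi_mul, ← mul_assoc, ← mul_assoc, ← pow_two, qchi_sq s hs, one_mul]

lemma qg_norm_sq (ψ : AddChar F ℂ) (hψ : ψ ≠ 1) (h2 : (2 : F) ≠ 0) :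
    ‖qg ψ 1‖ = Real.sqrt (Fintype.card F) := by
  have h : qg ψ 1 * (starRingEnd ℂ) (qg ψ 1) = Fintype.card F := by
    have e1 : qg ψ 1 * (starRingEnd ℂ) (qg ψ 1) = ∑ y : F, ∑ x : F, ψ (x ^ 2 - y ^ 2) := by
      rw [mul_comm, qg, map_sum, Finset.sum_mul_sum]
      refine Finset.sum_congr rfl fun y _ => Finset.sum_congr rfl fun x _ => ?_
      rw [← AddChar.map_neg_eq_conj, ← AddChar.map_add_eq_mul]
      congr 1; ring
    have e2 : ∀ y : F, ∑ x : F, ψ (x ^ 2 - y ^ 2) = ∑ z : F, ψ (z ^ 2) * ψ ((2 * z) * y) := by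
      intro y
      refine (Fintype.sum_equiv (Equiv.addRight y) _ _ fun z => ?_).symm
      rw [← AddChar.map_add_eq_mul, Equiv.coe_addRight]
      congr 1; ring
    rw [e1, Finset.sum_congr rfl (fun y _ => e2 y), Finset.sum_comm]
    simp only [← Finset.mul_sum, sum_char_mul' ψ hψ, mul_eq_zero, h2, false_or]
    simp
  rw [Complex.mul_conj, Complex.normSq_eq_norm_sq] at h
  have h' : ‖qg ψ 1‖ ^ 2 = Fintype.card F := by exact_mod_cast h
  rw [← h', Real.sqrt_sq (norm_nonneg _)]

lemma quad_sum (ψ : AddChar F ℂ) (hψ : ψ ≠ 1) (h2 : ringChar F ≠ 2) (s m : F) (hs : s ≠ 0) :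
    ∑ y : F, ψ (s * y ^ 2 + m * y) = ψ (-(m ^ 2 / (4 * s))) * (qchi s * qg ψ 1) := by
  have h20 : (2 : F) ≠ 0 := Ring.two_ne_zero h2
  have h4 : (4 : F) ≠ 0 := by
    have : (4 : F) = 2 * 2 := by norm_num
    rw [this]; exact mul_ne_zero h20 h20
  rw [← qg_chi ψ hψ h2 s hs, qg, Finset.mul_sum]
  refine Fintype.sum_equiv (Equiv.addRight (m / (2 * s))) _ _ fun y => ?_
  rw [← AddChar.map_add_eq_mul, Equiv.coe_addRight]
  congr 1
  field_simp
  ring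

/-- Salié sum bound. -/
lemma salie_bound (ψ : AddChar F ℂ) (hψ : ψ ≠ 1) (h2 : ringChar F ≠ 2) (t : F) :
    ‖∑ s : F, if s = 0 then (0 : ℂ) else ψ (-s) * ψ (-(t / (4 * s))) * qchi s‖ ≤
      2 * Real.sqrt (Fintype.card F) := by
  have h20 : (2 : F) ≠ 0 := Ring.two_ne_zero h2
  have h22 : (4 : F) = 2 * 2 := by norm_num
  have h4 : (4 : F) ≠ 0 := by
    rw [h22]; exact mul_ne_zero h20 h20
  have hq0 : (0 : ℝ) < Fintype.card F := by exact_mod_cast Fintype.card_pos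
  set T := ∑ s : F, if s = 0 then (0 : ℂ) else ψ (-s) * ψ (-(t / (4 * s))) * qchi s with hT
  by_cases hsq : IsSquare t
  · obtain ⟨m, rfl⟩ := hsq
    have e1 : T * qg ψ 1 = ∑ s : F, if s = 0 then (0 : ℂ) else
        ∑ y : F, ψ (-s) * ψ (s * y ^ 2 + m * y) := by
      rw [hT, Finset.sum_mul]
      refine Finset.sum_congr rfl fun s _ => ?_
      split_ifs with hs
      · simp
      · rw [← Finset.mul_sum, quad_sum ψ hψ h2 s m hs, pow_two]; ring
    have e2 : T * qg ψ 1 = (∑ s : F, ∑ y : F, ψ (-s) * ψ (s * y ^ 2 + m * y)) - ∑ y : F, ψ (m * y) := by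
      rw [e1, ← Finset.add_sum_erase _ _ (Finset.mem_univ (0 : F)),
        ← Finset.add_sum_erase _ (fun s => ∑ y : F, ψ (-s) * ψ (s * y ^ 2 + m * y)) (Finset.mem_univ (0 : F))]
      rw [Finset.sum_congr rfl (fun s hs => if_neg (Finset.ne_of_mem_erase hs))]
      simp
    have e3 : (∑ s : F, ∑ y : F, ψ (-s) * ψ (s * y ^ 2 + m * y)) =
        Fintype.card F * (ψ m + ψ (-m)) := by
      rw [Finset.sum_comm]
      have : ∀ y : F, ∑ s : F, ψ (-s) * ψ (s * y ^ 2 + m * y) =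
          (if y = 1 then (Fintype.card F : ℂ) * ψ m else 0) +
            (if y = -1 then (Fintype.card F : ℂ) * ψ (-m) else 0) := by
        intro y
        have e4 : ∀ s : F, ψ (-s) * ψ (s * y ^ 2 + m * y) = ψ (m * y) * ψ (s * (y ^ 2 - 1)) := by
          intro s
          rw [← AddChar.map_add_eq_mul, ← AddChar.map_add_eq_mul]
          congr 1; ring
        rw [Finset.sum_congr rfl (fun s _ => e4 s), ← Finset.mul_sum, sum_char_mul ψ hψ]
        have h11 : (1 : F) ≠ -1 := by
          intro h; apply h20; linear_combination h
        by_cases hy1 : y = 1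
        · subst hy1; simp [h11, mul_comm]
        by_cases hy2 : y = -1
        · subst hy2; simp [h11.symm, mul_comm]
        have : y ^ 2 - 1 ≠ 0 := by
          intro h
          have : (y - 1) * (y + 1) = 0 := by linear_combination h
          rcases mul_eq_zero.1 this with h | h
          · exact hy1 (sub_eq_zero.1 h)
          · exact hy2 (eq_neg_of_add_eq_zero_left h)
        simp [hy1, hy2, this]
      rw [Finset.sum_congr rfl (fun y _ => this y), Finset.sum_add_distrib]
      simp
      ring
    have e5 : ‖T * qg ψ 1‖ ≤ 2 * Fintype.card F := by
      rw [e2, e3, sum_char_mul' ψ hψ]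
      by_cases hm : m = 0
      · subst hm
        simp
        rw [show (Fintype.card F : ℂ) * (1 + 1) - Fintype.card F = Fintype.card F by ring,
          Complex.norm_natCast]
        linarith
      · rw [if_neg hm, sub_zero, norm_mul, Complex.norm_natCast, mul_comm]
        have : ‖ψ m + ψ (-m)‖ ≤ 2 := by
          refine (norm_add_le _ _).trans ?_
          rw [AddChar.norm_apply, AddChar.norm_apply]; norm_num
        gcongr
    rw [norm_mul, qg_norm_sq ψ hψ h20] at e5
    have hs0 : 0 < Real.sqrt (Fintype.card F) := Real.sqrt_pos.2 hq0
    have hss := Real.mul_self_sqrt hq0.le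
    refine le_of_mul_le_mul_right ?_ hs0
    linarith
  · have ht0 : t ≠ 0 := fun h => hsq (h ▸ IsSquare.zero)
    have hχ : qchi t = -1 := by
      rw [qchi, quadraticChar_neg_one_iff_not_isSquare.2 hsq]; simp
    have hχ4 : qchi (4 : F) = 1 := by rw [h22, qchi_mul, ← pow_two, qchi_sq _ h20]
    have hinv : T = -T := by
      conv_lhs => rw [hT]
      rw [hT, ← Finset.sum_neg_distrib]
      have hne : t / 4 ≠ 0 := div_ne_zero ht0 h4
      refine Fintype.sum_equiv ((Equiv.inv F).trans (Equiv.mulLeft₀ (t / 4) hne)) _ _ fun s => ?_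
      simp only [Equiv.trans_apply, Equiv.inv_apply, Equiv.mulLeft₀_apply, mul_eq_zero, hne,
        inv_eq_zero, false_or]
      split_ifs with hs
      · simp
      · rw [div_eq_mul_inv t 4, qchi_mul, qchi_mul, qchi_inv _ hs, qchi_inv _ h4, hχ4, hχ]
        have a1 : t / (4 * (t * 4⁻¹ * s⁻¹)) = s := by field_simp
        have a2 : t / (4 * s) = t * 4⁻¹ * s⁻¹ := by field_simp
        rw [a1, a2]; ring
    have : T = 0 := by
      have : 2 * T = 0 := by linear_combination hinv
      simpa using this
    rw [this, norm_zero]; positivity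

lemma R_bound (ψ : AddChar F ℂ) (hψ : ψ ≠ 1) (hodd : Odd (Fintype.card F)) (h2 : ringChar F ≠ 2)
    (t : F) (d : ℕ) :
    ‖∑ s : F, if s = 0 then (0 : ℂ) else ψ (-s) * ψ (-(t / (4 * s))) * qchi s ^ d‖ ≤
      2 * Real.sqrt (Fintype.card F) := by
  have h20 : (2 : F) ≠ 0 := Ring.two_ne_zero h2
  have h4 : (4 : F) ≠ 0 := by
    have : (4 : F) = 2 * 2 := by norm_num
    rw [this]; exact mul_ne_zero h20 h20
  rcases Nat.even_or_odd' d with ⟨k, rfl | rfl⟩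
  · have e : ∀ s : F, (if s = 0 then (0 : ℂ) else ψ (-s) * ψ (-(t / (4 * s))) * qchi s ^ (2 * k)) =
        if s = 0 then 0 else AddChar.mulShift ψ (-1) (s + (t / 4) * s⁻¹) := by
      intro s
      split_ifs with hs
      · rfl
      · rw [pow_mul, qchi_sq s hs, one_pow, mul_one, AddChar.mulShift_apply,
          ← AddChar.map_add_eq_mul]
        congr 1
        field_simp
        ring
    rw [Finset.sum_congr rfl (fun s _ => e s)]
    by_cases ht : t = 0
    · subst ht
      have hsum := sum_char_mul' ψ hψ (-1)
      rw [if_neg (by simp), ← Finset.add_sum_erase _ _ (Finset.mem_univ (0 : F))] at hsum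
      rw [← Finset.add_sum_erase _ _ (Finset.mem_univ (0 : F)),
        Finset.sum_congr rfl (fun s hs => if_neg (Finset.ne_of_mem_erase hs))]
      simp only [AddChar.mulShift_apply, zero_div, zero_mul, add_zero, if_true, zero_add]
      rw [mul_zero, AddChar.map_zero_eq_one] at hsum
      rw [show (∑ s ∈ Finset.univ.erase (0 : F), ψ (-1 * s)) = -1 by linear_combination hsum]
      rw [norm_neg, norm_one]
      have : (1 : ℝ) ≤ Real.sqrt (Fintype.card F) := by
        rw [Real.one_le_sqrt]; exact_mod_cast Fintype.card_pos
      linarith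
    · exact kloosterman_bound _ (mulShift_ne_one ψ hψ (-1) (by simp)) _ (div_ne_zero ht h4) hodd
  · have e : ∀ s : F, (if s = 0 then (0 : ℂ) else ψ (-s) * ψ (-(t / (4 * s))) * qchi s ^ (2 * k + 1)) =
        if s = 0 then 0 else ψ (-s) * ψ (-(t / (4 * s))) * qchi s := by
      intro s
      split_ifs with hs
      · rfl
      · rw [pow_succ, pow_mul, qchi_sq s hs, one_pow, one_mul]
    rw [Finset.sum_congr rfl (fun s _ => e s)]
    exact salie_bound ψ hψ h2 t

lemma map_fsum (ψ : AddChar F ℂ) {d : ℕ} (f : Fin d → F) : ψ (∑ j, f j) = ∏ j, ψ (f j) := by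
  have h := map_prod ψ.toMonoidHom (fun j => Multiplicative.ofAdd (f j)) Finset.univ
  rw [← ofAdd_sum] at h
  exact h

lemma orth (ψ : AddChar F ℂ) (hψ : ψ ≠ 1) {d : ℕ} (z : Fin d → F) :
    ∑ m : Fin d → F, ψ (∑ j, m j * z j) = if z = 0 then (Fintype.card F : ℂ) ^ d else 0 := by
  simp only [map_fsum]
  rw [← Fintype.prod_sum (fun j (y : F) => ψ (y * z j))]
  simp only [sum_char_mul ψ hψ]
  split_ifs with h
  · subst h; simp
  · obtain ⟨j, hj⟩ := Function.ne_iff.1 h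
    exact Finset.prod_eq_zero (Finset.mem_univ j) (if_neg hj)

/-- Fourier transform of the unit sphere. -/
noncomputable def sphF (ψ : AddChar F ℂ) {d : ℕ} (m : Fin d → F) : ℂ :=
  ∑ x : Fin d → F, if ∑ j, x j ^ 2 = 1 then ψ (∑ j, m j * x j) else 0

lemma sphF_bound (ψ : AddChar F ℂ) (hψ : ψ ≠ 1) (hodd : Odd (Fintype.card F)) (h2 : ringChar F ≠ 2)
    {d : ℕ} (m : Fin d → F) :
    ‖(Fintype.card F : ℂ) * sphF ψ m - if m = 0 then (Fintype.card F : ℂ) ^ d else 0‖ ≤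
      2 * Real.sqrt (Fintype.card F) ^ (d + 1) := by
  have e1 : (Fintype.card F : ℂ) * sphF ψ m =
      ∑ s : F, ψ (-s) * ∏ j, ∑ y : F, ψ (s * y ^ 2 + m j * y) := by
    have h1 : ∀ x : Fin d → F, ((Fintype.card F : ℂ) * if ∑ j, x j ^ 2 = 1 then ψ (∑ j, m j * x j) else 0)
        = ∑ s : F, ψ (s * (∑ j, x j ^ 2 - 1)) * ψ (∑ j, m j * x j) := by
      intro x
      rw [← Finset.sum_mul, sum_char_mul ψ hψ]
      simp only [sub_eq_zero]
      split_ifs <;> simp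
    rw [sphF, Finset.mul_sum, Finset.sum_congr rfl (fun x _ => h1 x), Finset.sum_comm]
    refine Finset.sum_congr rfl fun s _ => ?_
    rw [Fintype.prod_sum, Finset.mul_sum]
    refine Finset.sum_congr rfl fun x _ => ?_
    rw [← map_fsum, ← AddChar.map_add_eq_mul, ← AddChar.map_add_eq_mul, Finset.sum_add_distrib,
      ← Finset.mul_sum]
    congr 1; ring
  have e0 : ∏ j, ∑ y : F, ψ (0 * y ^ 2 + m j * y) = if m = 0 then (Fintype.card F : ℂ) ^ d else 0 := by
    rw [← orth ψ hψ m, Fintype.prod_sum]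
    refine Finset.sum_congr rfl fun x _ => ?_
    rw [map_fsum]
    refine Finset.prod_congr rfl fun j _ => ?_
    congr 1; ring
  have e2 : (Fintype.card F : ℂ) * sphF ψ m - (if m = 0 then (Fintype.card F : ℂ) ^ d else 0) =
      (∑ s : F, if s = 0 then (0 : ℂ) else ψ (-s) * ψ (-((∑ j, m j ^ 2) / (4 * s))) * qchi s ^ d) *
        qg ψ 1 ^ d := by
    rw [e1, ← e0, ← Finset.add_sum_erase _ _ (Finset.mem_univ (0 : F)),
      ← Finset.add_sum_erase _ (fun s => if s = 0 then (0 : ℂ) else _) (Finset.mem_univ (0 : F)),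
      Finset.sum_congr rfl (fun s hs => if_neg (Finset.ne_of_mem_erase hs))]
    simp only [neg_zero, AddChar.map_zero_eq_one, one_mul, if_true, zero_add, add_sub_cancel_left]
    rw [Finset.sum_mul]
    refine Finset.sum_congr rfl fun s hs => ?_
    have hs0 : s ≠ 0 := Finset.ne_of_mem_erase hs
    simp only [quad_sum ψ hψ h2 s _ hs0]
    rw [Finset.prod_mul_distrib, ← map_fsum, Finset.prod_const, Finset.card_univ, Fintype.card_fin,
      mul_pow, Finset.sum_neg_distrib, ← Finset.sum_div]
    ring
  rw [e2, norm_mul, norm_pow, qg_norm_sq ψ hψ (Ring.two_ne_zero h2), pow_succ]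
  have := R_bound ψ hψ hodd h2 (∑ j, m j ^ 2) d
  calc _ ≤ (2 * Real.sqrt (Fintype.card F)) * Real.sqrt (Fintype.card F) ^ d := by gcongr
    _ = _ := by ring

end Gauss

section Four
variable {F : Type} [Field F] [Fintype F] [DecidableEq F] {d : ℕ}

noncomputable def fh (ψ : AddChar F ℂ) (f : (Fin d → F) → ℝ) (m : Fin d → F) : ℂ :=
  ∑ x : Fin d → F, (f x : ℂ) * ψ (∑ j, m j * x j)

lemma four_id (ψ : AddChar F ℂ) (hψ : ψ ≠ 1) (a : (Fin d → F) → ℂ) (f g : (Fin d → F) → ℝ) :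
    ∑ m : Fin d → F, (∑ w : Fin d → F, a w * ψ (∑ j, m j * w j)) *
      ((starRingEnd ℂ) (fh ψ f m) * fh ψ g m) =
    (Fintype.card F : ℂ) ^ d * ∑ x : Fin d → F, ∑ y : Fin d → F, (f x : ℂ) * g y * a (x - y) := by
  have h1 : ∀ m : Fin d → F, (∑ w : Fin d → F, a w * ψ (∑ j, m j * w j)) *
      ((starRingEnd ℂ) (fh ψ f m) * fh ψ g m) =
      ∑ x : Fin d → F, ∑ y : Fin d → F, ∑ w : Fin d → F, (f x : ℂ) * g y * a w *
        ψ (∑ j, m j * (w - (x - y)) j) := by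
    intro m
    rw [fh, fh, map_sum, Finset.sum_mul_sum, mul_comm, Finset.sum_mul]
    refine Finset.sum_congr rfl fun x _ => ?_
    rw [Finset.sum_mul]
    refine Finset.sum_congr rfl fun y _ => ?_
    rw [Finset.mul_sum]
    refine Finset.sum_congr rfl fun w _ => ?_
    have : ∑ j, m j * (w - (x - y)) j = -(∑ j, m j * x j) + (∑ j, m j * y j) + ∑ j, m j * w j := by
      rw [← Finset.sum_neg_distrib, ← Finset.sum_add_distrib, ← Finset.sum_add_distrib]
      refine Finset.sum_congr rfl fun j _ => ?_
      simp only [Pi.sub_apply]; ring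
    rw [this, AddChar.map_add_eq_mul, AddChar.map_add_eq_mul, AddChar.map_neg_eq_conj, map_mul,
      Complex.conj_ofReal]
    ring
  rw [Finset.sum_congr rfl (fun m _ => h1 m), Finset.sum_comm, Finset.mul_sum]
  refine Finset.sum_congr rfl fun x _ => ?_
  rw [Finset.sum_comm, Finset.mul_sum]
  refine Finset.sum_congr rfl fun y _ => ?_
  rw [Finset.sum_comm]
  simp only [← Finset.mul_sum, orth ψ hψ, sub_eq_zero]
  simp
  ring

lemma parseval (ψ : AddChar F ℂ) (hψ : ψ ≠ 1) (f : (Fin d → F) → ℝ) :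
    ∑ m : Fin d → F, ‖fh ψ f m‖ ^ 2 = (Fintype.card F : ℝ) ^ d * ∑ x, f x ^ 2 := by
  have h := four_id ψ hψ (fun w => if w = 0 then 1 else 0) f f
  simp only [ite_mul, one_mul, zero_mul, Finset.sum_ite_eq', Finset.mem_univ, if_true, sub_eq_zero,
    mul_ite, mul_one, mul_zero, Finset.sum_ite_eq] at h
  simp only [Pi.zero_apply, mul_zero, Finset.sum_const_zero, AddChar.map_zero_eq_one, one_mul,
    Complex.conj_mul'] at h
  have h' : ((∑ m : Fin d → F, ‖fh ψ f m‖ ^ 2 : ℝ) : ℂ) =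
      (((Fintype.card F : ℝ) ^ d * ∑ x, f x ^ 2 : ℝ) : ℂ) := by
    push_cast
    rw [h]
    congr 1
    exact Finset.sum_congr rfl fun x _ => by ring
  exact_mod_cast h'

noncomputable def bil (f g : (Fin d → F) → ℝ) : ℝ :=
  ∑ x : Fin d → F, ∑ y : Fin d → F, f x * g y * if ∑ j, (x j - y j) ^ 2 = 1 then 1 else 0

lemma bil_bound (hodd : Odd (Fintype.card F)) (f g : (Fin d → F) → ℝ) :
    Fintype.card F * bil f g ≤ |∑ x, f x| * |∑ x, g x| +
      2 * Real.sqrt (Fintype.card F) ^ (d + 1) * (Real.sqrt (∑ x, f x ^ 2) * Real.sqrt (∑ x, g x ^ 2)) := by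
  have h2 : ringChar F ≠ 2 := by
    intro h
    have := FiniteField.even_card_of_char_two h
    rw [Nat.odd_iff] at hodd
    omega
  obtain ⟨ψ, hψ⟩ : ∃ ψ : AddChar F ℂ, ψ ≠ 1 := by
    refine ⟨AddChar.FiniteField.primitiveChar_to_Complex F, ?_⟩
    have := AddChar.FiniteField.primitiveChar_to_Complex_isPrimitive F (one_ne_zero (α := F))
    rwa [AddChar.mulShift_one] at this
  have hq0 : (0 : ℝ) < Fintype.card F := by exact_mod_cast Fintype.card_pos
  set q := Fintype.card F with hq
  have h1 := four_id ψ hψ (fun w => if ∑ j, w j ^ 2 = 1 then 1 else 0) f g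
  have h3 : ∀ m : Fin d → F, (∑ w : Fin d → F, (if ∑ j, w j ^ 2 = 1 then (1 : ℂ) else 0) *
      ψ (∑ j, m j * w j)) = sphF ψ m := by
    intro m
    rw [sphF]
    exact Finset.sum_congr rfl fun w _ => by split_ifs <;> simp
  simp only [h3] at h1
  have h4 : ∑ x : Fin d → F, ∑ y : Fin d → F, (f x : ℂ) * g y *
      (if ∑ j, (x - y) j ^ 2 = 1 then (1 : ℂ) else 0) = (bil f g : ℂ) := by
    rw [bil]; push_cast
    refine Finset.sum_congr rfl fun x _ => Finset.sum_congr rfl fun y _ => ?_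
    simp only [Pi.sub_apply]
    split_ifs <;> simp
  rw [h4, ← hq] at h1
  have h5 : (q : ℂ) ^ d * (q * (bil f g : ℂ)) =
      ∑ m : Fin d → F, ((q : ℂ) * sphF ψ m - if m = 0 then (q : ℂ) ^ d else 0) *
        ((starRingEnd ℂ) (fh ψ f m) * fh ψ g m) +
      (q : ℂ) ^ d * ((starRingEnd ℂ) (fh ψ f 0) * fh ψ g 0) := by
    simp only [sub_mul, Finset.sum_sub_distrib, mul_assoc, ← Finset.mul_sum, h1]
    simp
    ring
  have h0 : ∀ f : (Fin d → F) → ℝ, fh ψ f 0 = ((∑ x, f x : ℝ) : ℂ) := by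
    intro f; simp [fh]
  have h6 := congrArg norm h5
  have hl : ‖(q : ℂ) ^ d * (q * (bil f g : ℂ))‖ = (q : ℝ) ^ d * (q * |bil f g|) := by
    simp
  rw [hl] at h6
  have hd0 : (0 : ℝ) < (q : ℝ) ^ d := by positivity
  have h7 : (q : ℝ) ^ d * (q * |bil f g|) ≤
      2 * Real.sqrt q ^ (d + 1) * ((q : ℝ) ^ d * (Real.sqrt (∑ x, f x ^ 2) * Real.sqrt (∑ x, g x ^ 2)))
      + (q : ℝ) ^ d * (|∑ x, f x| * |∑ x, g x|) := by
    rw [h6]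
    refine (norm_add_le _ _).trans (add_le_add ?_ ?_)
    · refine (norm_sum_le _ _).trans ?_
      calc _ ≤ ∑ m : Fin d → F, 2 * Real.sqrt q ^ (d + 1) * (‖fh ψ f m‖ * ‖fh ψ g m‖) := by
            refine Finset.sum_le_sum fun m _ => ?_
            rw [norm_mul, norm_mul, RCLike.norm_conj]
            gcongr
            exact sphF_bound ψ hψ hodd h2 m
        _ ≤ _ := by
            rw [← Finset.mul_sum]
            gcongr
            refine (Real.sum_mul_le_sqrt_mul_sqrt _ _ _).trans_eq ?_
            rw [parseval ψ hψ, parseval ψ hψ, ← hq, Real.sqrt_mul hd0.le, Real.sqrt_mul hd0.le]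
            have := Real.mul_self_sqrt hd0.le
            linear_combination (Real.sqrt (∑ x, f x ^ 2) * Real.sqrt (∑ x, g x ^ 2)) * this
    · rw [h0, h0, norm_mul, norm_mul, RCLike.norm_conj]
      simp only [norm_pow, Complex.norm_natCast, Complex.norm_real, Real.norm_eq_abs]
      exact le_rfl
  have h8 : (q : ℝ) * bil f g ≤ q * |bil f g| := by gcongr; exact le_abs_self _
  refine h8.trans (le_of_mul_le_mul_left ?_ hd0)
  linarith

lemma sum_supp (E : Finset (Fin d → F)) (f : (Fin d → F) → ℝ) (hf : ∀ x, x ∉ E → f x = 0) :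
    |∑ x, f x| ≤ Real.sqrt E.card * Real.sqrt (∑ x, f x ^ 2) := by
  rw [← Real.sqrt_mul (by positivity), ← Real.sqrt_sq_eq_abs]
  refine Real.sqrt_le_sqrt ?_
  have h1 : ∑ x, f x = ∑ x ∈ E, f x :=
    (Finset.sum_subset (Finset.subset_univ _) fun x _ hx => hf x hx).symm
  have h2 : ∑ x, f x ^ 2 = ∑ x ∈ E, f x ^ 2 :=
    (Finset.sum_subset (Finset.subset_univ _) fun x _ hx => by rw [hf x hx]; simp).symm
  rw [h1, h2]
  exact sq_sum_le_card_mul_sum_sq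

lemma bil_bound' (hodd : Odd (Fintype.card F)) (E : Finset (Fin d → F)) (f g : (Fin d → F) → ℝ)
    (hf : ∀ x, x ∉ E → f x = 0) (hg : ∀ x, x ∉ E → g x = 0) :
    bil f g ≤ ((E.card + 2 * Real.sqrt (Fintype.card F) ^ (d + 1)) / Fintype.card F) *
      (Real.sqrt (∑ x, f x ^ 2) * Real.sqrt (∑ x, g x ^ 2)) := by
  have hq0 : (0 : ℝ) < Fintype.card F := by exact_mod_cast Fintype.card_pos
  have h := bil_bound hodd f g
  have h1 := mul_le_mul (sum_supp E f hf) (sum_supp E g hg) (abs_nonneg _) (by positivity)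
  have h2 : Real.sqrt E.card * Real.sqrt E.card = (E.card : ℝ) := Real.mul_self_sqrt (by positivity)
  rw [div_mul_eq_mul_div, le_div_iff₀ hq0, mul_comm]
  refine h.trans ?_
  rw [add_mul]
  refine add_le_add (h1.trans_eq ?_) le_rfl
  linear_combination (Real.sqrt (∑ x, f x ^ 2) * Real.sqrt (∑ x, g x ^ 2)) * h2

noncomputable def cv (E : Finset (Fin d → F)) : ℕ → (Fin d → F) → ℝ
  | 0, x => if x ∈ E then 1 else 0
  | n + 1, x => if x ∈ E then ∑ y, (if ∑ j, (x j - y j) ^ 2 = 1 then 1 else 0) * cv E n y else 0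

lemma cv_supp (E : Finset (Fin d → F)) (n : ℕ) (x : Fin d → F) (hx : x ∉ E) : cv E n x = 0 := by
  cases n <;> simp [cv, hx]

lemma chain_weight (E : Finset (Fin d → F)) (n : ℕ) (φ : (Fin d → F) → ℝ) :
    (∑ x : Fin (n + 1) → (Fin d → F), if ((∀ i, x i ∈ E) ∧
      ∀ i : Fin n, ∑ j, (x i.castSucc j - x i.succ j) ^ 2 = 1) then φ (x 0) else 0) =
    ∑ a, φ a * cv E n a := by
  induction n generalizing φ with
  | zero =>
    refine Fintype.sum_equiv (Equiv.funUnique (Fin 1) _) _ _ fun x => ?_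
    simp [cv, Fin.forall_fin_one]
  | succ n ih =>
    rw [← (Fin.consEquiv (fun _ => (Fin d → F))).sum_comp, Fintype.sum_prod_type_right]
    have h1 : ∀ x : Fin (n + 1) → (Fin d → F), ∀ a : Fin d → F,
        (if ((∀ i, (Fin.consEquiv (fun _ => (Fin d → F))) (a, x) i ∈ E) ∧
          ∀ i : Fin (n + 1), ∑ j, ((Fin.consEquiv (fun _ => (Fin d → F))) (a, x) i.castSucc j -
            (Fin.consEquiv (fun _ => (Fin d → F))) (a, x) i.succ j) ^ 2 = 1) then
          φ ((Fin.consEquiv (fun _ => (Fin d → F))) (a, x) 0) else 0) =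
        if ((∀ i, x i ∈ E) ∧ ∀ i : Fin n, ∑ j, (x i.castSucc j - x i.succ j) ^ 2 = 1) then
          (if a ∈ E ∧ ∑ j, (a j - x 0 j) ^ 2 = 1 then φ a else 0) else 0 := by
      intro x a
      rw [← ite_and]
      simp only [Fin.consEquiv_apply, Fin.forall_fin_succ (n := n + 1), Fin.cons_zero, Fin.cons_succ]
      refine if_congr ?_ rfl rfl
      rw [Fin.forall_fin_succ (P := fun i : Fin (n + 1) => ∑ j, ((Fin.cons a x : Fin (n + 2) → (Fin d → F)) i.castSucc j - x i j) ^ 2 = 1)]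
      simp only [Fin.castSucc_zero, Fin.cons_zero, ← Fin.succ_castSucc, Fin.cons_succ]
      tauto
    have h2 : ∀ x : Fin (n + 1) → (Fin d → F),
        (∑ a : Fin d → F, if ((∀ i, x i ∈ E) ∧ ∀ i : Fin n, ∑ j, (x i.castSucc j - x i.succ j) ^ 2 = 1) then
          (if a ∈ E ∧ ∑ j, (a j - x 0 j) ^ 2 = 1 then φ a else 0) else 0) =
        if ((∀ i, x i ∈ E) ∧ ∀ i : Fin n, ∑ j, (x i.castSucc j - x i.succ j) ^ 2 = 1) then
          (fun b => ∑ a : Fin d → F, if a ∈ E ∧ ∑ j, (a j - b j) ^ 2 = 1 then φ a else 0) (x 0) else 0 := by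
      intro x
      split_ifs <;> simp
    simp only [h1]
    rw [Finset.sum_congr rfl (fun x _ => h2 x)]
    refine (ih (fun b => ∑ a : Fin d → F,
      if a ∈ E ∧ ∑ j, (a j - b j) ^ 2 = 1 then φ a else 0)).trans ?_
    simp only [Finset.sum_mul]
    rw [Finset.sum_comm]
    refine Finset.sum_congr rfl fun a _ => ?_
    by_cases ha : a ∈ E
    · simp only [ha, true_and, cv, if_true, Finset.mul_sum]
      refine Finset.sum_congr rfl fun b _ => ?_
      split_ifs <;> simp
    · simp [ha, cv]

lemma chainCount_eq (E : Finset (Fin d → F)) (n : ℕ) :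
    (chainCount E n : ℝ) = ∑ a, cv E n a := by
  have := chain_weight E n (fun _ => 1)
  simp only [one_mul] at this
  rw [← this, chainCount, Finset.card_filter]
  push_cast
  rfl

lemma cv_norm (hodd : Odd (Fintype.card F)) (E : Finset (Fin d → F)) (n : ℕ) :
    Real.sqrt (∑ x, cv E n x ^ 2) ≤
      ((E.card + 2 * Real.sqrt (Fintype.card F) ^ (d + 1)) / Fintype.card F) ^ n * Real.sqrt E.card := by
  set M : ℝ := (E.card + 2 * Real.sqrt (Fintype.card F) ^ (d + 1)) / Fintype.card F with hM
  have hM0 : 0 ≤ M := by positivity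
  induction n with
  | zero =>
    rw [pow_zero, one_mul]
    refine Real.sqrt_le_sqrt (le_of_eq ?_)
    simp [cv]
  | succ n ih =>
    have h1 : ∑ x, cv E (n + 1) x ^ 2 = bil (cv E (n + 1)) (cv E n) := by
      rw [bil]
      refine Finset.sum_congr rfl fun x _ => ?_
      by_cases hx : x ∈ E
      · rw [pow_two]
        nth_rewrite 2 [cv]
        rw [if_pos hx, Finset.mul_sum]
        exact Finset.sum_congr rfl fun y _ => by ring
      · simp [cv_supp E (n + 1) x hx]
    have h2 := bil_bound' hodd E (cv E (n + 1)) (cv E n) (cv_supp E _) (cv_supp E _)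
    rw [← h1, ← hM] at h2
    set A := Real.sqrt (∑ x, cv E (n + 1) x ^ 2) with hA
    set B := Real.sqrt (∑ x, cv E n x ^ 2) with hB
    have hA0 : 0 ≤ A := Real.sqrt_nonneg _
    have hAA : A * A = ∑ x, cv E (n + 1) x ^ 2 :=
      Real.mul_self_sqrt (Finset.sum_nonneg fun _ _ => sq_nonneg _)
    rw [← hAA] at h2
    have h3 : A ≤ M * B := by
      rcases hA0.eq_or_lt with h | h
      · rw [← h]; positivity
      · refine le_of_mul_le_mul_left ?_ h
        linarith
    calc A ≤ M * B := h3
      _ ≤ M * (M ^ n * Real.sqrt E.card) := by gcongr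
      _ = _ := by ring

end Four

theorem statement9 {F : Type} [Field F] [Fintype F] [DecidableEq F]
    (q : ℕ) (hq : Fintype.card F = q) (hodd : Odd q)
    (d : ℕ) (hd : 2 ≤ d)
    (E : Finset (Fin d → F)) :
    ∀ n : ℕ, (chainCount E n : ℝ) ≤
      (E.card : ℝ) * (((E.card : ℝ) + 2 * (q : ℝ) ^ (((d : ℝ) + 1) / 2)) / (q : ℝ)) ^ n := by
  intro n
  subst hq
  have h1 := cv_norm hodd E n
  have h2 := sum_supp E (cv E n) (cv_supp E n)
  have hr : (Fintype.card F : ℝ) ^ (((d : ℝ) + 1) / 2) = Real.sqrt (Fintype.card F) ^ (d + 1) := by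
    rw [Real.sqrt_eq_rpow, ← Real.rpow_natCast, ← Real.rpow_mul (by positivity)]
    congr 1; push_cast; ring
  rw [hr, chainCount_eq]
  refine (le_abs_self _).trans (h2.trans ?_)
  have hE : Real.sqrt E.card * Real.sqrt E.card = (E.card : ℝ) := Real.mul_self_sqrt (by positivity)
  refine (mul_le_mul_of_nonneg_left h1 (Real.sqrt_nonneg _)).trans_eq ?_
  linear_combination ((E.card + 2 * Real.sqrt (Fintype.card F) ^ (d + 1)) / Fintype.card F : ℝ) ^ n * hE
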